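/- arXiv:1210.4126 — 4 statements merged into one kernel-verified Lean document; each statement's English description precedes it below -/
import Mathlib

section
/- Let f: ℝⁿ → [0,1] be measurable, t > 0, fₜ = Pₜf the Ornstein–Uhlenbeck evolution, and vₜ = Φ^{-1} ∘ fₜ. Then vₜ is kₜ-Lipschitz, i.e. |∇vₜ(x)| ≤ kₜ = (e^{2t} - 1)^{-1/2} for all x ∈ ℝⁿ. -/
open MeasureTheory Real ProbabilityTheory

noncomputable section

/-- The standard Gaussian measure on ℝⁿ. -/
def stdGaussian (n : ℕ) : Measure (Fin n → ℝ) := Measure.pi fun _ => gaussianReal 0 1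

/-- The standard Gaussian density φ. -/
def gphi (x : ℝ) : ℝ := (Real.sqrt (2 * Real.pi))⁻¹ * Real.exp (-x ^ 2 / 2)

/-- The standard Gaussian CDF Φ. -/
def gPhi (x : ℝ) : ℝ := ∫ t in Set.Iic x, gphi t

/-- The Ornstein–Uhlenbeck semigroup Pₜ. -/
def OU (n : ℕ) (t : ℝ) (f : (Fin n → ℝ) → ℝ) (x : Fin n → ℝ) : ℝ :=
  ∫ y, f (fun i => Real.exp (-t) * x i + Real.sqrt (1 - Real.exp (-2 * t)) * y i)
    ∂(stdGaussian n)


/-- A product of measures with densities has the product density. -/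
lemma pi_withDensity_eq_withDensity_prod {ι : Type*} [Fintype ι] {α : ι → Type*}
    [∀ i, MeasurableSpace (α i)] (μ : ∀ i, Measure (α i)) [∀ i, IsProbabilityMeasure (μ i)]
    (ρ : ∀ i, α i → ENNReal) (hρ : ∀ i, Measurable (ρ i))
    [∀ i, SigmaFinite ((μ i).withDensity (ρ i))] :
    Measure.pi (fun i => (μ i).withDensity (ρ i))
      = (Measure.pi μ).withDensity (fun x => ∏ i, ρ i (x i)) := by
  classical
  refine Measure.pi_eq fun s hs => ?_
  have hind : ∀ x : (∀ i, α i), (Set.univ.pi s).indicator (fun x => ∏ i, ρ i (x i)) x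
      = ∏ i, (s i).indicator (ρ i) (x i) := by
    intro x
    by_cases hx : x ∈ Set.univ.pi s
    · rw [Set.indicator_of_mem hx]
      exact Finset.prod_congr rfl fun i _ => (Set.indicator_of_mem (hx i trivial) _).symm
    · rw [Set.indicator_of_notMem hx]
      simp only [Set.mem_pi, not_forall] at hx
      obtain ⟨i, -, hi⟩ := hx
      exact (Finset.prod_eq_zero (Finset.mem_univ i) (Set.indicator_of_notMem hi _)).symm
  have hmeas : ∀ i, Measurable ((s i).indicator (ρ i)) := fun i => (hρ i).indicator (hs i)
  rw [withDensity_apply _ (MeasurableSet.univ_pi hs), ← lintegral_indicator (.univ_pi hs)]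
  simp_rw [hind]
  rw [lintegral_prod_eq_prod_lintegral_of_indepFun Finset.univ
    (fun i (x : ∀ i, α i) => (s i).indicator (ρ i) (x i))
    (iIndepFun_pi fun i => (hmeas i).aemeasurable)
    (fun i => (hmeas i).comp (measurable_pi_apply i))]
  refine Finset.prod_congr rfl fun i _ => ?_
  rw [(measurePreserving_eval μ i).lintegral_comp (hmeas i),
    lintegral_indicator (hs i), withDensity_apply _ (hs i)]

/-- One-dimensional Cameron–Martin density. -/
lemma gaussianReal_eq_withDensity_exp (a : ℝ) :
    gaussianReal a 1 = (gaussianReal 0 1).withDensity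
      (fun y => ENNReal.ofReal (Real.exp (a * y - a ^ 2 / 2))) := by
  rw [gaussianReal_of_var_ne_zero _ one_ne_zero, gaussianReal_of_var_ne_zero _ one_ne_zero,
    ← withDensity_mul _ (measurable_gaussianPDF _ _) (by fun_prop)]
  congr 1
  ext y
  simp only [Pi.mul_apply, gaussianPDF_def, gaussianPDFReal_def]
  rw [← ENNReal.ofReal_mul (by positivity), mul_assoc (_⁻¹), ← Real.exp_add]
  congr 3
  simp
  ring

/-- Cameron–Martin formula for the standard Gaussian measure on `ι → ℝ`. -/
lemma integral_add_pi_gaussianReal {ι : Type*} [Fintype ι] (w : ι → ℝ) (g : (ι → ℝ) → ℝ)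
    (hg : Measurable g) :
    ∫ y, g (fun i => y i + w i) ∂(Measure.pi fun _ : ι => gaussianReal 0 1)
      = ∫ y, Real.exp (∑ i, (w i * y i - w i ^ 2 / 2)) * g y
          ∂(Measure.pi fun _ : ι => gaussianReal 0 1) := by
  have hmap : (Measure.pi fun _ : ι => gaussianReal 0 1).map (fun y i => y i + w i)
      = Measure.pi fun i => gaussianReal (w i) 1 := by
    have h (i : ι) : (gaussianReal 0 1).map (fun y => y + w i) = gaussianReal (w i) 1 := by
      rw [gaussianReal_map_add_const, zero_add]
    have : ∀ i, SigmaFinite ((gaussianReal 0 1).map (fun y => y + w i)) := fun i => by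
      rw [h]; infer_instance
    rw [Measure.pi_map_pi (f := fun i y => y + w i) (fun i => by fun_prop)]
    simp_rw [h]
  have hdens : (Measure.pi fun i => gaussianReal (w i) 1)
      = (Measure.pi fun _ : ι => gaussianReal 0 1).withDensity
        (fun y => ENNReal.ofReal (Real.exp (∑ i, (w i * y i - w i ^ 2 / 2)))) := by
    have : ∀ i, SigmaFinite ((gaussianReal 0 1).withDensity
        (fun y => ENNReal.ofReal (Real.exp (w i * y - w i ^ 2 / 2)))) := fun i => by
      rw [← gaussianReal_eq_withDensity_exp]; infer_instance
    simp_rw [gaussianReal_eq_withDensity_exp (w _)]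
    rw [pi_withDensity_eq_withDensity_prod (fun _ => gaussianReal 0 1)
      (fun i y => ENNReal.ofReal (Real.exp (w i * y - w i ^ 2 / 2))) (fun i => by fun_prop)]
    simp_rw [Real.exp_sum]
    congr 1
    ext y
    rw [ENNReal.ofReal_prod_of_nonneg fun i _ => (Real.exp_pos _).le]
  rw [← integral_map (φ := fun (y : ι → ℝ) i => y i + w i) (f := g)
    (Measurable.aemeasurable (by fun_prop)) hg.aestronglyMeasurable, hmap, hdens,
    integral_withDensity_eq_integral_toReal_smul (by fun_prop)
      (ae_of_all _ fun _ => ENNReal.ofReal_lt_top)]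
  simp [ENNReal.toReal_ofReal (Real.exp_pos _).le]

lemma integrable_exp_linear_pi_gaussianReal {ι : Type*} [Fintype ι] (w : ι → ℝ) :
    Integrable (fun y : ι → ℝ => Real.exp (∑ i, (w i * y i - w i ^ 2 / 2)))
      (Measure.pi fun _ : ι => gaussianReal 0 1) := by
  simp_rw [Real.exp_sum]
  refine Integrable.fintype_prod (f := fun i y => Real.exp (w i * y - w i ^ 2 / 2)) fun i => ?_
  simp_rw [Real.exp_sub]
  exact (integrable_exp_mul_gaussianReal (w i)).div_const _

/-- A unit linear functional of a standard Gaussian vector is standard Gaussian. -/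
lemma map_linear_pi_gaussianReal {ι : Type*} [Fintype ι] (u : ι → ℝ) (hu : ∑ i, u i ^ 2 = 1) :
    (Measure.pi fun _ : ι => gaussianReal 0 1).map (fun y => ∑ i, u i * y i)
      = gaussianReal 0 1 := by
  have hm : Measurable fun y : ι → ℝ => ∑ i, u i * y i := by fun_prop
  have := Measure.isProbabilityMeasure_map (μ := Measure.pi fun _ : ι => gaussianReal 0 1)
    hm.aemeasurable
  refine Measure.ext_of_charFun (funext fun s => ?_)
  have hprod (y : ι → ℝ) : Complex.exp (s * ((∑ i, u i * y i : ℝ) : ℂ) * Complex.I)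
      = ∏ i, Complex.exp ((s * u i : ℝ) * y i * Complex.I) := by
    rw [← Complex.exp_sum]
    congr 1
    push_cast
    rw [Finset.mul_sum, Finset.sum_mul]
    exact Finset.sum_congr rfl fun i _ => by ring
  rw [charFun_apply_real, integral_map hm.aemeasurable (by fun_prop)]
  simp_rw [hprod]
  rw [integral_fintype_prod_eq_prod
    (f := fun i (y : ℝ) => Complex.exp ((s * u i : ℝ) * y * Complex.I))]
  simp_rw [← charFun_apply_real, charFun_gaussianReal]
  rw [← Complex.exp_sum]
  congr 1
  have : ∑ i, ((u i : ℂ)) ^ 2 = 1 := by exact_mod_cast hu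
  simp only [Complex.ofReal_zero, mul_zero, zero_mul, zero_sub, NNReal.coe_one,
    Complex.ofReal_one, one_mul, Complex.ofReal_mul, mul_pow]
  rw [Finset.sum_neg_distrib, ← Finset.sum_div, ← Finset.mul_sum, this, mul_one]

lemma gphi_pos (x : ℝ) : 0 < gphi x := by
  unfold gphi; positivity

lemma gphi_eq_gaussianPDFReal : gphi = gaussianPDFReal 0 1 := by
  ext x
  simp [gphi, gaussianPDFReal_def]

lemma integrable_gphi : Integrable gphi := by
  rw [gphi_eq_gaussianPDFReal]
  exact integrable_gaussianPDFReal 0 1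

lemma gPhi_eq_gaussianReal_real_Iic (b : ℝ) : gPhi b = (gaussianReal 0 1).real (Set.Iic b) := by
  rw [gPhi, gphi_eq_gaussianPDFReal, Measure.real, gaussianReal_apply_eq_integral _ one_ne_zero,
    ENNReal.toReal_ofReal]
  exact integral_nonneg fun _ => gaussianPDFReal_nonneg _ _ _

lemma strictMono_gPhi : StrictMono gPhi := by
  intro a b hab
  have h := intervalIntegral.integral_Iic_sub_Iic (a := a) (b := b)
    integrable_gphi.integrableOn integrable_gphi.integrableOn
  have hpos := intervalIntegral.intervalIntegral_pos_of_pos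
    (integrable_gphi.intervalIntegrable (a := a) (b := b)) gphi_pos hab
  rw [← h] at hpos
  exact sub_pos.mp hpos

/-- The standard Gaussian measure of a half-space. -/
lemma integral_indicator_halfSpace_pi_gaussianReal {ι : Type*} [Fintype ι] (u : ι → ℝ)
    (hu : ∑ i, u i ^ 2 = 1) (b : ℝ) :
    ∫ y, {y : ι → ℝ | ∑ i, u i * y i ≤ b}.indicator 1 y
      ∂(Measure.pi fun _ : ι => gaussianReal 0 1) = gPhi b := by
  have hm : Measurable fun y : ι → ℝ => ∑ i, u i * y i := by fun_prop
  rw [integral_indicator_one (measurableSet_le hm measurable_const), gPhi_eq_gaussianReal_real_Iic]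
  have h := map_measureReal_apply (μ := Measure.pi fun _ : ι => gaussianReal 0 1) hm
    (measurableSet_Iic (a := b))
  rw [map_linear_pi_gaussianReal u hu] at h
  exact h.symm

/-- Neyman–Pearson: superlevel sets `{c ≤ L}` maximise `∫ L g` among tests `g` of given mean. -/
lemma integral_mul_le_of_superlevel {α : Type*} [MeasurableSpace α] (μ : Measure α)
    [IsFiniteMeasure μ] (L g : α → ℝ) (hL : Integrable L μ) (hg : Measurable g)
    (hg01 : ∀ y, g y ∈ Set.Icc (0 : ℝ) 1) (c : ℝ) (H : Set α) (hH : MeasurableSet H)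
    (hin : ∀ y ∈ H, c ≤ L y) (hout : ∀ y ∉ H, L y ≤ c)
    (heq : ∫ y, g y ∂μ = ∫ y, H.indicator 1 y ∂μ) :
    ∫ y, L y * g y ∂μ ≤ ∫ y, L y * H.indicator 1 y ∂μ := by
  have hgi : Integrable g μ := Integrable.of_mem_Icc 0 1 hg.aemeasurable (ae_of_all _ hg01)
  have hHi : Integrable (H.indicator (1 : α → ℝ)) μ := (integrable_const 1).indicator hH
  have hLg : Integrable (fun y => L y * g y) μ :=
    hL.mul_bdd (c := 1) hg.aestronglyMeasurable
      (ae_of_all _ fun y => by rw [Real.norm_of_nonneg (hg01 y).1]; exact (hg01 y).2)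
  have hLH : Integrable (fun y => L y * H.indicator (1 : α → ℝ) y) μ :=
    hL.mul_bdd (c := 1) hHi.aestronglyMeasurable
      (ae_of_all _ fun y => by by_cases h : y ∈ H <;> simp [h])
  have key : ∫ y, (L y * g y - c * g y) ∂μ
      ≤ ∫ y, (L y * H.indicator (1 : α → ℝ) y - c * H.indicator (1 : α → ℝ) y) ∂μ := by
    refine integral_mono (hLg.sub (hgi.const_mul c)) (hLH.sub (hHi.const_mul c)) fun y => ?_
    have h01 := hg01 y
    by_cases h : y ∈ H
    · have := hin y h
      simp only [Set.indicator_of_mem h, Pi.one_apply]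
      nlinarith [h01.2]
    · have := hout y h
      simp only [Set.indicator_of_notMem h]
      nlinarith [h01.1]
  rw [integral_sub hLg (hgi.const_mul c), integral_sub hLH (hHi.const_mul c),
    integral_const_mul, integral_const_mul, heq] at key
  linarith

/-- Translating by a vector of length `r` increases `Φ⁻¹` of a Gaussian mean by at most `r`. -/
lemma integral_translate_le_gPhi_add {ι : Type*} [Fintype ι] (g : (ι → ℝ) → ℝ)
    (hg : Measurable g) (hg01 : ∀ y, g y ∈ Set.Icc (0 : ℝ) 1) (u : ι → ℝ)
    (hu : ∑ i, u i ^ 2 = 1) (r : ℝ) (hr : 0 ≤ r) (c : ℝ)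
    (hc : ∫ y, g y ∂(Measure.pi fun _ : ι => gaussianReal 0 1) = gPhi c) :
    ∫ y, g (fun i => y i + r * u i) ∂(Measure.pi fun _ : ι => gaussianReal 0 1)
      ≤ gPhi (c + r) := by
  set H : Set (ι → ℝ) := {y | ∑ i, (-u i) * y i ≤ c} with hHdef
  have hHm : MeasurableSet H := measurableSet_le (by fun_prop) measurable_const
  have hu' : ∑ i, (-u i) ^ 2 = 1 := by simpa using hu
  have hexp (y : ι → ℝ) : ∑ i, ((r * u i) * y i - (r * u i) ^ 2 / 2)
      = -r * (∑ i, (-u i) * y i) - r ^ 2 / 2 := by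
    have h2 : r ^ 2 / 2 = ∑ i, r ^ 2 / 2 * u i ^ 2 := by rw [← Finset.mul_sum, hu, mul_one]
    rw [h2, Finset.mul_sum, ← Finset.sum_sub_distrib]
    exact Finset.sum_congr rfl fun i _ => by ring
  have hshift (y : ι → ℝ) : H.indicator (1 : (ι → ℝ) → ℝ) (fun i => y i + r * u i)
      = {y : ι → ℝ | ∑ i, (-u i) * y i ≤ c + r}.indicator 1 y := by
    have : ∑ i, (-u i) * (y i + r * u i) = (∑ i, (-u i) * y i) - r := by
      have h2 : r = ∑ i, r * u i ^ 2 := by rw [← Finset.mul_sum, hu, mul_one]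
      conv_rhs => rw [h2]
      rw [← Finset.sum_sub_distrib]
      exact Finset.sum_congr rfl fun i _ => by ring
    simp only [Set.indicator_apply, hHdef, Set.mem_ofPred_eq, this, sub_le_iff_le_add]
    rfl
  rw [← integral_indicator_halfSpace_pi_gaussianReal (fun i => -u i) hu' (c + r)]
  simp_rw [← hshift]
  rw [integral_add_pi_gaussianReal (fun i => r * u i) g hg,
    integral_add_pi_gaussianReal (fun i => r * u i) (H.indicator 1)
      (measurable_const.indicator hHm)]
  refine integral_mul_le_of_superlevel _ _ g
    (integrable_exp_linear_pi_gaussianReal fun i => r * u i) hg hg01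
    (Real.exp (-r * c - r ^ 2 / 2)) H hHm (fun y hy => ?_) (fun y hy => ?_) ?_
  · rw [hexp]
    have : ∑ i, (-u i) * y i ≤ c := hy
    exact Real.exp_le_exp.mpr (by nlinarith)
  · rw [hexp]
    have : c < ∑ i, (-u i) * y i := not_le.mp hy
    exact Real.exp_le_exp.mpr (by nlinarith)
  · rw [hc, integral_indicator_halfSpace_pi_gaussianReal (fun i => -u i) hu' c]

lemma sqrt_one_sub_exp_mul_inv_sqrt {t : ℝ} (ht : 0 < t) :
    Real.sqrt (1 - Real.exp (-2 * t)) * (Real.sqrt (Real.exp (2 * t) - 1))⁻¹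
      = Real.exp (-t) := by
  have hpos : 0 < Real.exp (2 * t) - 1 := by
    have := Real.one_lt_exp_iff.mpr (by linarith : 0 < 2 * t)
    linarith
  have h : 1 - Real.exp (-2 * t) = Real.exp (-t) ^ 2 * (Real.exp (2 * t) - 1) := by
    rw [mul_sub, ← Real.exp_nat_mul, ← Real.exp_add]
    push_cast
    ring_nf
    simp
    ring
  rw [h, Real.sqrt_mul (sq_nonneg _), Real.sqrt_sq (Real.exp_pos _).le, mul_assoc,
    mul_inv_cancel₀ (Real.sqrt_pos.mpr hpos).ne', mul_one]

/-- Any `v` with `Φ ∘ v = Pₜ f` grows at rate at most `kₜ` along unit vectors. -/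
lemma le_add_of_gPhi_eq_OU (n : ℕ) (f : (Fin n → ℝ) → ℝ) (hf : Measurable f)
    (hf01 : ∀ x, f x ∈ Set.Icc (0 : ℝ) 1) (t : ℝ) (ht : 0 < t) (v : (Fin n → ℝ) → ℝ)
    (hvt : ∀ x, gPhi (v x) = OU n t f x) (x u : Fin n → ℝ) (hu : ∑ i, u i ^ 2 = 1)
    (s : ℝ) (hs : 0 ≤ s) :
    v (x + s • u) ≤ v x + s * (Real.sqrt (Real.exp (2 * t) - 1))⁻¹ := by
  rw [← strictMono_gPhi.le_iff_le, hvt, OU]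
  have h := integral_translate_le_gPhi_add
    (fun y => f (fun i => Real.exp (-t) * x i + Real.sqrt (1 - Real.exp (-2 * t)) * y i))
    (hf.comp (by fun_prop)) (fun y => hf01 _) u hu
    (s * (Real.sqrt (Real.exp (2 * t) - 1))⁻¹) (by positivity) (v x) (hvt x).symm
  refine le_trans (le_of_eq ?_) h
  refine integral_congr_ae (ae_of_all _ fun y => congrArg f (funext fun i => ?_))
  have hk := sqrt_one_sub_exp_mul_inv_sqrt ht
  simp only [Pi.add_apply, Pi.smul_apply, smul_eq_mul]
  rw [← hk]
  ring

/-- for measurable f : ℝⁿ → [0,1], t > 0 and vₜ = Φ⁻¹ ∘ Pₜf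
(i.e. any differentiable v with Φ ∘ v = Pₜ f), the Euclidean norm of the gradient
of vₜ is bounded by kₜ = (e^{2t}-1)^{-1/2}. -/
theorem gradient_bound_v (n : ℕ) (f : (Fin n → ℝ) → ℝ) (hf : Measurable f)
    (hf01 : ∀ x, f x ∈ Set.Icc (0 : ℝ) 1) (t : ℝ) (ht : 0 < t)
    (v : (Fin n → ℝ) → ℝ) (hv : Differentiable ℝ v)
    (hvt : ∀ x, gPhi (v x) = OU n t f x) (x : Fin n → ℝ) :
    Real.sqrt (∑ i, (fderiv ℝ v x (Pi.single i 1)) ^ 2)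
      ≤ (Real.sqrt (Real.exp (2 * t) - 1))⁻¹ := by
  have hsq : 0 ≤ ∑ i, (fderiv ℝ v x (Pi.single i 1)) ^ 2 := Finset.sum_nonneg fun i _ => sq_nonneg _
  set G : Fin n → ℝ := fun i => fderiv ℝ v x (Pi.single i 1)
  change Real.sqrt (∑ i, G i ^ 2) ≤ _
  set R := Real.sqrt (∑ i, G i ^ 2)
  have hR2 : R ^ 2 = ∑ i, G i ^ 2 := Real.sq_sqrt hsq
  rcases (Real.sqrt_nonneg _ : 0 ≤ R).eq_or_lt with h0 | hpos
  · exact h0.symm.le.trans (by positivity)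
  have hR0 : R ≠ 0 := hpos.ne'
  set u : Fin n → ℝ := R⁻¹ • G with hu
  have hu1 : ∑ i, u i ^ 2 = 1 := by
    simp only [hu, Pi.smul_apply, smul_eq_mul, mul_pow]
    rw [← Finset.mul_sum, ← hR2]
    field_simp
  have hDu : fderiv ℝ v x u = R := by
    have hsum : u = ∑ i, u i • (Pi.single i 1 : Fin n → ℝ) := by
      simpa using (pi_eq_sum_univ' u)
    rw [hsum, map_sum]
    simp only [map_smul, smul_eq_mul]
    change ∑ i, (R⁻¹ * G i) * G i = R
    calc ∑ i, (R⁻¹ * G i) * G i = R⁻¹ * ∑ i, G i ^ 2 := by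
          rw [Finset.mul_sum]; exact Finset.sum_congr rfl fun i _ => by ring
      _ = R := by rw [← hR2]; field_simp
  have hline : HasLineDerivAt ℝ v (fderiv ℝ v x u) x u := (hv x).hasFDerivAt.hasLineDerivAt u
  rw [hDu] at hline
  have hslope := (hasDerivWithinAt_iff_tendsto_slope' (s := Set.Ioi (0 : ℝ)) (by simp)).mp
    (HasDerivAt.hasDerivWithinAt hline)
  refine le_of_tendsto hslope ?_
  filter_upwards [self_mem_nhdsWithin] with s (hs : 0 < s)
  have := le_add_of_gPhi_eq_OU n f hf hf01 t ht v hvt x u hu1 s hs.le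
  rw [slope_def_field, sub_zero, zero_smul, add_zero, div_le_iff₀ hs]
  linarith
end
end

section
/- Let f: ℝⁿ → ℝ be 1-Lipschitz with median M (with respect to γₙ). Then for every 0 < λ < 1, ∫ exp(λ f(x)²/2) dγₙ(x) ≤ (2/√(1-λ)) · exp(λM²/(2(1-λ))). -/
open MeasureTheory Real ProbabilityTheory
open scoped ENNReal

noncomputable section

section

open Set Filter Topology
open scoped NNReal

/-- The standard Gaussian density. -/
def normalPDF (x : ℝ) : ℝ := gaussianPDFReal 0 1 x

/-- The standard Gaussian distribution function. -/
def normalCDF (x : ℝ) : ℝ := cdf (gaussianReal 0 1) x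

lemma normalPDF_eq (x : ℝ) : normalPDF x = (√(2 * π))⁻¹ * rexp (-(x ^ 2 / 2)) := by
  simp [normalPDF, gaussianPDFReal, neg_div]

lemma normalPDF_pos (x : ℝ) : 0 < normalPDF x := gaussianPDFReal_pos _ _ _ one_ne_zero

lemma normalPDF_neg (x : ℝ) : normalPDF (-x) = normalPDF x := by simp [normalPDF_eq]

lemma hasDerivAt_normalPDF (x : ℝ) : HasDerivAt normalPDF (-(x * normalPDF x)) x := by
  have h : HasDerivAt (fun x : ℝ => (√(2 * π))⁻¹ * rexp (-(x ^ 2 / 2)))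
      ((√(2 * π))⁻¹ * (rexp (-(x ^ 2 / 2)) * (-((2 : ℕ) * x ^ (2 - 1) / 2)))) x :=
    (((hasDerivAt_pow 2 x).div_const 2).neg.exp).const_mul _
  have h2 : normalPDF = fun x : ℝ => (√(2 * π))⁻¹ * rexp (-(x ^ 2 / 2)) := funext normalPDF_eq
  rw [h2]
  refine h.congr_deriv ?_
  push_cast; ring

lemma continuous_normalPDF : Continuous normalPDF :=
  continuous_iff_continuousAt.2 fun x => (hasDerivAt_normalPDF x).continuousAt

lemma normalPDF_le_one (x : ℝ) : normalPDF x ≤ 1 := by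
  rw [normalPDF_eq]
  have h1 : (1 : ℝ) ≤ √(2 * π) := by
    rw [Real.one_le_sqrt]; linarith [Real.pi_gt_three]
  have h2 : rexp (-(x ^ 2 / 2)) ≤ 1 := by
    rw [Real.exp_le_one_iff]; nlinarith [sq_nonneg x]
  calc _ ≤ (1 : ℝ) * 1 := by
        gcongr
        exact inv_le_one_of_one_le₀ h1
    _ = 1 := one_mul 1

lemma abs_mul_normalPDF_le_one (x : ℝ) : |x * normalPDF x| ≤ 1 := by
  rw [normalPDF_eq, abs_mul, abs_mul, abs_of_pos (Real.exp_pos _)]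
  have h1 : (1 : ℝ) ≤ √(2 * π) := by
    rw [Real.one_le_sqrt]; linarith [Real.pi_gt_three]
  have h0 : |(√(2 * π))⁻¹| ≤ 1 := by
    rw [abs_of_nonneg (by positivity)]; exact inv_le_one_of_one_le₀ h1
  have h2 : |x| * rexp (-(x ^ 2 / 2)) ≤ 1 := by
    rw [Real.exp_neg, ← div_eq_mul_inv, div_le_one (Real.exp_pos _)]
    have := Real.add_one_le_exp (x ^ 2 / 2)
    nlinarith [sq_nonneg (|x| - 1), sq_abs x]
  calc |x| * (|(√(2 * π))⁻¹| * rexp (-(x ^ 2 / 2)))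
      = |(√(2 * π))⁻¹| * (|x| * rexp (-(x ^ 2 / 2))) := by ring
    _ ≤ 1 * 1 := by gcongr
    _ = 1 := one_mul 1

lemma normalCDF_eq_integral (x : ℝ) : normalCDF x = ∫ y in Iic x, normalPDF y := by
  rw [normalCDF, cdf_eq_real, Measure.real, gaussianReal_apply_eq_integral _ one_ne_zero,
    ENNReal.toReal_ofReal]
  · rfl
  · exact integral_nonneg fun y => (normalPDF_pos y).le

lemma integrable_normalPDF : Integrable normalPDF := integrable_gaussianPDFReal 0 1

lemma hasDerivAt_normalCDF (x : ℝ) : HasDerivAt normalCDF (normalPDF x) x := by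
  have h : normalCDF = fun x => normalCDF 0 + ∫ y in (0 : ℝ)..x, normalPDF y := by
    funext x
    rw [normalCDF_eq_integral, normalCDF_eq_integral,
      ← intervalIntegral.integral_Iic_sub_Iic integrable_normalPDF.integrableOn
        integrable_normalPDF.integrableOn]
    ring
  rw [h]
  exact (continuous_normalPDF.integral_hasStrictDerivAt 0 x).hasDerivAt.const_add _

lemma continuous_normalCDF : Continuous normalCDF :=
  continuous_iff_continuousAt.2 fun x => (hasDerivAt_normalCDF x).continuousAt

lemma strictMono_normalCDF : StrictMono normalCDF :=
  strictMono_of_deriv_pos fun x => by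
    rw [(hasDerivAt_normalCDF x).deriv]; exact normalPDF_pos x

lemma normalCDF_mem (x : ℝ) : normalCDF x ∈ Ioo (0 : ℝ) 1 :=
  ⟨(cdf_nonneg _ (x - 1)).trans_lt (strictMono_normalCDF (by linarith)),
    (strictMono_normalCDF (by linarith : x < x + 1)).trans_le (cdf_le_one _ _)⟩

lemma tendsto_normalCDF_atTop : Tendsto normalCDF atTop (𝓝 1) := tendsto_cdf_atTop _

lemma tendsto_normalCDF_atBot : Tendsto normalCDF atBot (𝓝 0) := tendsto_cdf_atBot _

lemma exists_normalCDF_eq {p : ℝ} (hp : p ∈ Ioo (0 : ℝ) 1) : ∃ x, normalCDF x = p :=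
  mem_range_of_exists_le_of_exists_ge continuous_normalCDF
    ((tendsto_normalCDF_atBot.eventually (gt_mem_nhds hp.1)).exists.imp fun _ h => h.le)
    ((tendsto_normalCDF_atTop.eventually (lt_mem_nhds hp.2)).exists.imp fun _ h => h.le)

lemma normalCDF_neg (x : ℝ) : normalCDF (-x) = 1 - normalCDF x := by
  have hd : ∀ y, HasDerivAt (fun y => normalCDF (-y) + normalCDF y) 0 y := fun y => by
    have h1 := ((hasDerivAt_normalCDF (-y)).comp y (hasDerivAt_neg y)).add (hasDerivAt_normalCDF y)
    refine h1.congr_deriv ?_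
    rw [normalPDF_neg]; ring
  have hconst : ∀ y, normalCDF (-y) + normalCDF y = normalCDF (-x) + normalCDF x := fun y =>
    is_const_of_deriv_eq_zero (fun z => (hd z).differentiableAt) (fun z => (hd z).deriv) y x
  have hlim : Tendsto (fun y => normalCDF (-y) + normalCDF y) atTop (𝓝 (0 + 1)) :=
    (tendsto_normalCDF_atBot.comp tendsto_neg_atTop_atBot).add tendsto_normalCDF_atTop
  have := tendsto_nhds_unique hlim
    ((tendsto_const_nhds (x := normalCDF (-x) + normalCDF x)).congr fun y => (hconst y).symm)
  linarith

lemma normalCDF_zero : normalCDF 0 = 1 / 2 := by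
  have := normalCDF_neg 0
  rw [neg_zero] at this
  linarith

/-- The Gaussian quantile function, the inverse of `normalCDF` on `(0, 1)`. -/
def probit : ℝ → ℝ := Function.invFun normalCDF

lemma probit_normalCDF (x : ℝ) : probit (normalCDF x) = x :=
  Function.leftInverse_invFun strictMono_normalCDF.injective x

lemma normalCDF_probit {p : ℝ} (hp : p ∈ Ioo (0 : ℝ) 1) : normalCDF (probit p) = p :=
  Function.invFun_eq (exists_normalCDF_eq hp)

lemma probit_le_probit {p q : ℝ} (hp : p ∈ Ioo (0 : ℝ) 1) (hq : q ∈ Ioo (0 : ℝ) 1)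
    (h : p ≤ q) : probit p ≤ probit q := by
  rw [← strictMono_normalCDF.le_iff_le, normalCDF_probit hp, normalCDF_probit hq]
  exact h

lemma probit_one_sub {p : ℝ} (hp : p ∈ Ioo (0 : ℝ) 1) : probit (1 - p) = -probit p := by
  apply strictMono_normalCDF.injective
  rw [normalCDF_neg, normalCDF_probit hp, normalCDF_probit ⟨by linarith [hp.2], by linarith [hp.1]⟩]

lemma probit_half : probit (1 / 2) = 0 := by rw [← normalCDF_zero, probit_normalCDF]

lemma hasDerivAt_probit {p : ℝ} (hp : p ∈ Ioo (0 : ℝ) 1) :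
    HasDerivAt probit (normalPDF (probit p))⁻¹ p := by
  have hn : Ioo (0 : ℝ) 1 ∈ 𝓝 p := isOpen_Ioo.mem_nhds hp
  have him : probit '' Ioo (0 : ℝ) 1 = univ :=
    eq_univ_of_forall fun x => ⟨normalCDF x, normalCDF_mem x, probit_normalCDF x⟩
  have hc : ContinuousAt probit p :=
    continuousAt_of_monotoneOn_of_image_mem_nhds
      (fun a ha b hb hab => probit_le_probit ha hb hab) hn (by rw [him]; exact univ_mem)
  exact HasDerivAt.of_local_left_inverse hc (hasDerivAt_normalCDF _) (normalPDF_pos _).ne'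
    (by filter_upwards [hn] with q hq using normalCDF_probit hq)

/-- The Gaussian isoperimetric profile. -/
def gaussianProfile (p : ℝ) : ℝ := normalPDF (probit p)

lemma gaussianProfile_pos (p : ℝ) : 0 < gaussianProfile p := normalPDF_pos _

lemma gaussianProfile_normalCDF (x : ℝ) : gaussianProfile (normalCDF x) = normalPDF x := by
  rw [gaussianProfile, probit_normalCDF]

lemma gaussianProfile_one_sub {p : ℝ} (hp : p ∈ Ioo (0 : ℝ) 1) :
    gaussianProfile (1 - p) = gaussianProfile p := by
  rw [gaussianProfile, probit_one_sub hp, normalPDF_neg, gaussianProfile]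

lemma hasDerivAt_gaussianProfile_sq {p : ℝ} (hp : p ∈ Ioo (0 : ℝ) 1) :
    HasDerivAt (fun p => gaussianProfile p ^ 2) (-2 * (probit p * gaussianProfile p)) p := by
  have h := (((hasDerivAt_normalPDF (probit p)).comp p (hasDerivAt_probit hp)).pow 2)
  refine h.congr_deriv ?_
  have := (normalPDF_pos (probit p)).ne'
  simp only [Function.comp, gaussianProfile]
  field_simp
  push_cast; ring

lemma continuousAt_gaussianProfile {p : ℝ} (hp : p ∈ Ioo (0 : ℝ) 1) :
    ContinuousAt gaussianProfile p :=
  continuous_normalPDF.continuousAt.comp (hasDerivAt_probit hp).continuousAt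

lemma hasDerivAt_probit_mul_gaussianProfile {p : ℝ} (hp : p ∈ Ioo (0 : ℝ) 1) :
    HasDerivAt (fun p => probit p * gaussianProfile p) (1 - probit p ^ 2) p := by
  have h := (hasDerivAt_probit hp).mul
    ((hasDerivAt_normalPDF (probit p)).comp p (hasDerivAt_probit hp))
  refine h.congr_deriv ?_
  have := (normalPDF_pos (probit p)).ne'
  simp only [Function.comp]
  field_simp
  ring

lemma monotone_div_normalPDF : Monotone fun x => x / normalPDF x := by
  refine monotone_of_deriv_nonneg (fun x => ?_) fun x => ?_
  · exact ((hasDerivAt_id x).div (hasDerivAt_normalPDF x) (normalPDF_pos x).ne').differentiableAt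
  · have h := (hasDerivAt_id x).div (hasDerivAt_normalPDF x) (normalPDF_pos x).ne'
    have h' : deriv (fun x => x / normalPDF x) x = _ := h.deriv
    rw [h']
    have := normalPDF_pos x
    simp only [id]
    apply div_nonneg _ (by positivity)
    nlinarith [sq_nonneg x]

lemma convexOn_probit_sq : ConvexOn ℝ (Ioo (0 : ℝ) 1) fun p => probit p ^ 2 := by
  have hd : ∀ p ∈ Ioo (0 : ℝ) 1, HasDerivAt (fun p => probit p ^ 2)
      (2 * (probit p / normalPDF (probit p))) p := fun p hp => by
    refine ((hasDerivAt_probit hp).pow 2).congr_deriv ?_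
    push_cast; ring
  refine MonotoneOn.convexOn_of_deriv (convex_Ioo 0 1)
    (fun p hp => (hd p hp).continuousAt.continuousWithinAt)
    (fun p hp => ?_) ?_
  · rw [interior_Ioo] at hp
    exact (hd p hp).differentiableAt.differentiableWithinAt
  · rw [interior_Ioo]
    intro p hp q hq hpq
    rw [(hd p hp).deriv, (hd q hq).deriv]
    have := monotone_div_normalPDF (probit_le_probit hp hq hpq)
    linarith

/-- A function vanishing to first order at `0` with nonnegative second derivative is nonnegative. -/
lemma nonneg_of_second_deriv_nonneg {F F' F'' : ℝ → ℝ} {a : ℝ} (ha : 0 ≤ a)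
    (h1 : ∀ y ∈ Icc 0 a, HasDerivAt F (F' y) y) (h2 : ∀ y ∈ Icc 0 a, HasDerivAt F' (F'' y) y)
    (h0 : F 0 = 0) (h0' : F' 0 = 0) (hpos : ∀ y ∈ Icc 0 a, 0 ≤ F'' y) : 0 ≤ F a := by
  have key : ∀ (G G' : ℝ → ℝ), (∀ y ∈ Icc 0 a, HasDerivAt G (G' y) y) → G 0 = 0 →
      (∀ y ∈ Icc 0 a, 0 ≤ G' y) → ∀ y ∈ Icc 0 a, 0 ≤ G y := by
    intro G G' hG hG0 hG' y hy
    have hm : MonotoneOn G (Icc 0 a) := monotoneOn_of_deriv_nonneg (convex_Icc 0 a)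
      (fun z hz => (hG z hz).continuousAt.continuousWithinAt)
      (fun z hz => (hG z (interior_subset hz)).differentiableAt.differentiableWithinAt)
      (fun z hz => by rw [(hG z (interior_subset hz)).deriv]; exact hG' z (interior_subset hz))
    have := hm ⟨le_rfl, ha⟩ hy hy.1
    rwa [hG0] at this
  exact key F F' h1 h0 (key F' F'' h2 h0' hpos) a ⟨ha, le_rfl⟩

lemma two_mul_sqrt_le_of_sq_sub_sq_le {a b g : ℝ} (ha : 0 ≤ a) (hb : 0 ≤ b) (hg : 0 < g)
    (h : (a ^ 2 - b ^ 2) ^ 2 ≤ 8 * g ^ 2 * (a ^ 2 + b ^ 2 - 2 * g ^ 2)) : 2 * g ≤ a + b := by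
  by_contra! hlt
  have h1 : (a + b) ^ 2 < 4 * g ^ 2 := by nlinarith
  have h2 : (a - b) ^ 2 ≤ (a + b) ^ 2 := by nlinarith [mul_nonneg ha hb]
  have h3 : ((a + b) ^ 2 - 4 * g ^ 2) * ((a - b) ^ 2 - 4 * g ^ 2) ≤ 0 := by nlinarith
  nlinarith [mul_pos_of_neg_of_neg (sub_neg.2 h1) (sub_neg.2 (h2.trans_lt h1))]

lemma gaussianProfile_two_point_of_le_half {c x : ℝ} (hc : c ≤ 1 / 2) (hx : 0 ≤ x)
    (h0 : 0 < c - x) :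
    2 * gaussianProfile c ≤ √(gaussianProfile (c + x) ^ 2 + x ^ 2)
      + √(gaussianProfile (c - x) ^ 2 + x ^ 2) := by
  have hmem : ∀ y ∈ Icc 0 x, c + y ∈ Ioo (0 : ℝ) 1 ∧ c - y ∈ Ioo (0 : ℝ) 1 := fun y hy =>
    ⟨⟨by linarith [hy.1], by linarith [hy.2]⟩, ⟨by linarith [hy.2], by linarith [hy.1]⟩⟩
  have hcm : c ∈ Ioo (0 : ℝ) 1 := ⟨by linarith, by linarith⟩
  have hz : ∀ y ∈ Icc 0 x, probit (c + y) ^ 2 ≤ probit (c - y) ^ 2 := fun y hy => by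
    obtain ⟨hp, hm⟩ := hmem y hy
    have e1 : probit (c - y) ≤ probit (c + y) := probit_le_probit hm hp (by linarith [hy.1])
    have e2 : probit (c + y) ≤ -probit (c - y) := by
      rw [← probit_one_sub hm]
      exact probit_le_probit hp ⟨by linarith [hm.2], by linarith [hm.1]⟩ (by linarith)
    nlinarith
  have hU : ∀ y ∈ Icc 0 x,
      HasDerivAt (fun y => gaussianProfile (c + y) ^ 2)
        (-2 * (probit (c + y) * gaussianProfile (c + y))) y ∧
      HasDerivAt (fun y => gaussianProfile (c - y) ^ 2)
        (2 * (probit (c - y) * gaussianProfile (c - y))) y := fun y hy => by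
    obtain ⟨hp, hm⟩ := hmem y hy
    constructor
    · exact ((hasDerivAt_gaussianProfile_sq hp).comp y ((hasDerivAt_id y).const_add c)).congr_deriv
        (by simp)
    · exact ((hasDerivAt_gaussianProfile_sq hm).comp y ((hasDerivAt_id y).const_sub c)).congr_deriv
        (by simp)
  have hV : ∀ y ∈ Icc 0 x,
      HasDerivAt (fun y => probit (c + y) * gaussianProfile (c + y)) (1 - probit (c + y) ^ 2) y ∧
      HasDerivAt (fun y => probit (c - y) * gaussianProfile (c - y))
        (-(1 - probit (c - y) ^ 2)) y := fun y hy => by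
    obtain ⟨hp, hm⟩ := hmem y hy
    constructor
    · exact ((hasDerivAt_probit_mul_gaussianProfile hp).comp y
        ((hasDerivAt_id y).const_add c)).congr_deriv (by simp)
    · exact ((hasDerivAt_probit_mul_gaussianProfile hm).comp y
        ((hasDerivAt_id y).const_sub c)).congr_deriv (by simp)
  -- the odd part of the squared profile grows at most linearly
  have hD : gaussianProfile (c + x) ^ 2 - gaussianProfile (c - x) ^ 2
      ≤ -4 * (probit c * gaussianProfile c) * x := by
    have := nonneg_of_second_deriv_nonneg
      (F := fun y => gaussianProfile (c - y) ^ 2 - gaussianProfile (c + y) ^ 2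
        + -4 * (probit c * gaussianProfile c) * y)
      (F' := fun y => 2 * (probit (c - y) * gaussianProfile (c - y))
        - -2 * (probit (c + y) * gaussianProfile (c + y)) + -4 * (probit c * gaussianProfile c))
      (F'' := fun y => 2 * (-(1 - probit (c - y) ^ 2)) - -2 * (1 - probit (c + y) ^ 2)) hx
      (fun y hy => ((((hU y hy).2.sub (hU y hy).1).add
        ((hasDerivAt_id y).const_mul (-4 * (probit c * gaussianProfile c)))).congr_deriv
          (by ring)))
      (fun y hy => ((((hV y hy).2.const_mul 2).sub ((hV y hy).1.const_mul (-2))).add_const _))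
      (by simp) (by simp; ring) (fun y hy => by have := hz y hy; linarith)
    linarith
  -- its even part dominates a quadratic
  have hR : 2 * probit c ^ 2 * x ^ 2 ≤ gaussianProfile (c + x) ^ 2 + gaussianProfile (c - x) ^ 2
      - 2 * gaussianProfile c ^ 2 + 2 * x ^ 2 := by
    have := nonneg_of_second_deriv_nonneg
      (F := fun y => gaussianProfile (c + y) ^ 2 + gaussianProfile (c - y) ^ 2
        - 2 * gaussianProfile c ^ 2 + (2 - 2 * probit c ^ 2) * y ^ 2)
      (F' := fun y => -2 * (probit (c + y) * gaussianProfile (c + y))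
        + 2 * (probit (c - y) * gaussianProfile (c - y)) + (4 - 4 * probit c ^ 2) * y)
      (F'' := fun y => -2 * (1 - probit (c + y) ^ 2) + 2 * (-(1 - probit (c - y) ^ 2))
        + (4 - 4 * probit c ^ 2)) hx
      (fun y hy => ((((hU y hy).1.add (hU y hy).2).sub_const _).add
        ((hasDerivAt_pow 2 y).const_mul (2 - 2 * probit c ^ 2))).congr_deriv
          (by push_cast; ring))
      (fun y hy => ((((hV y hy).1.const_mul (-2)).add ((hV y hy).2.const_mul 2)).add
        ((hasDerivAt_id y).const_mul (4 - 4 * probit c ^ 2))).congr_deriv (by ring))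
      (by simp; ring) (by simp) (fun y hy => by
        obtain ⟨hp, hm⟩ := hmem y hy
        have hconv := convexOn_probit_sq.2 hp hm (by norm_num : (0 : ℝ) ≤ 1 / 2)
          (by norm_num : (0 : ℝ) ≤ 1 / 2) (by norm_num)
        have hcc : (1 / 2 : ℝ) • (c + y) + (1 / 2 : ℝ) • (c - y) = c := by
          simp only [smul_eq_mul]; ring
        rw [hcc] at hconv
        simp only [smul_eq_mul] at hconv
        linarith)
    linarith
  have hD0 : 0 ≤ gaussianProfile (c + x) ^ 2 - gaussianProfile (c - x) ^ 2 := by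
    have h := hz x ⟨hx, le_rfl⟩
    have : gaussianProfile (c - x) ≤ gaussianProfile (c + x) := by
      simp only [gaussianProfile, normalPDF_eq]
      gcongr
    have h' := (gaussianProfile_pos (c - x)).le
    nlinarith
  apply two_mul_sqrt_le_of_sq_sub_sq_le (Real.sqrt_nonneg _) (Real.sqrt_nonneg _)
    (gaussianProfile_pos c)
  rw [Real.sq_sqrt (by positivity), Real.sq_sqrt (by positivity)]
  have h1 := pow_le_pow_left₀ hD0 hD 2
  have h2 := mul_le_mul_of_nonneg_left hR (by positivity : 0 ≤ 8 * gaussianProfile c ^ 2)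
  calc _ = (gaussianProfile (c + x) ^ 2 - gaussianProfile (c - x) ^ 2) ^ 2 := by ring
    _ ≤ _ := h1
    _ = 8 * gaussianProfile c ^ 2 * (2 * probit c ^ 2 * x ^ 2) := by ring
    _ ≤ _ := h2
    _ = _ := by ring

/-- Bobkov's two-point inequality. -/
lemma gaussianProfile_two_point {a b : ℝ} (ha : a ∈ Ioo (0 : ℝ) 1) (hb : b ∈ Ioo (0 : ℝ) 1) :
    gaussianProfile ((a + b) / 2) ≤ (√(gaussianProfile a ^ 2 + ((a - b) / 2) ^ 2)
      + √(gaussianProfile b ^ 2 + ((a - b) / 2) ^ 2)) / 2 := by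
  wlog hab : b ≤ a generalizing a b
  · have := this hb ha (le_of_not_ge hab)
    rw [add_comm a b, ← neg_sub b a, neg_div, neg_sq, add_comm (√_)]
    exact this
  wlog hc : (a + b) / 2 ≤ 1 / 2 generalizing a b
  · have := this (a := 1 - b) (b := 1 - a) ⟨by linarith [hb.2], by linarith [hb.1]⟩
      ⟨by linarith [ha.2], by linarith [ha.1]⟩ (by linarith) (by linarith)
    rw [gaussianProfile_one_sub ha, gaussianProfile_one_sub hb,
      (by ring : (1 - b + (1 - a)) / 2 = 1 - (a + b) / 2),
      gaussianProfile_one_sub ⟨by linarith [ha.1, hb.1], by linarith [ha.2, hb.2]⟩,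
      (by ring : 1 - b - (1 - a) = a - b)] at this
    linarith
  have := gaussianProfile_two_point_of_le_half hc (x := (a - b) / 2) (by linarith)
    (by linarith [hb.1])
  rw [(by ring : (a + b) / 2 + (a - b) / 2 = a), (by ring : (a + b) / 2 - (a - b) / 2 = b)] at this
  linarith

section Walk

variable {E : Type*} [AddCommGroup E]

/-- The average of `h` over the endpoints of a walk from a given point whose steps are the members
of the list, each with an independent uniform sign. -/
def walkAvg : List E → (E → ℝ) → E → ℝ
  | [], h, x => h x
  | v :: l, h, x => (walkAvg l h (x + v) + walkAvg l h (x - v)) / 2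

lemma walkAvg_mono (l : List E) {g h : E → ℝ} (hgh : ∀ x, g x ≤ h x) (x : E) :
    walkAvg l g x ≤ walkAvg l h x := by
  induction l generalizing x with
  | nil => exact hgh x
  | cons v l ih => simp only [walkAvg]; linarith [ih (x + v), ih (x - v)]

lemma walkAvg_mem (l : List E) {h : E → ℝ} (hh : ∀ x, h x ∈ Ioo (0 : ℝ) 1) (x : E) :
    walkAvg l h x ∈ Ioo (0 : ℝ) 1 := by
  induction l generalizing x with
  | nil => exact hh x
  | cons v l ih =>
    simp only [walkAvg]
    exact ⟨by linarith [(ih (x + v)).1, (ih (x - v)).1],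
      by linarith [(ih (x + v)).2, (ih (x - v)).2]⟩

lemma abs_walkAvg_add_sub_le (l : List E) {h V : E → ℝ} {u : E}
    (hV : ∀ x, |h (x + u) - h x| / 2 ≤ V x) (x : E) :
    |walkAvg l h (x + u) - walkAvg l h x| / 2 ≤ walkAvg l V x := by
  induction l generalizing x with
  | nil => exact hV x
  | cons v l ih =>
    simp only [walkAvg]
    have h1 := ih (x + v)
    have h2 := ih (x - v)
    rw [add_right_comm] at h1
    rw [sub_add_eq_add_sub] at h2
    have h3 := abs_add_le (walkAvg l h (x + u + v) - walkAvg l h (x + v))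
      (walkAvg l h (x + u - v) - walkAvg l h (x - v))
    have h4 : (walkAvg l h (x + u + v) + walkAvg l h (x + u - v)) / 2
        - (walkAvg l h (x + v) + walkAvg l h (x - v)) / 2
        = ((walkAvg l h (x + u + v) - walkAvg l h (x + v))
          + (walkAvg l h (x + u - v) - walkAvg l h (x - v))) / 2 := by ring
    rw [h4, abs_div, abs_two]
    linarith

lemma sqrt_sq_add_sq_midpoint_le (a₁ a₂ b₁ b₂ : ℝ) :
    √(((a₁ + a₂) / 2) ^ 2 + ((b₁ + b₂) / 2) ^ 2)
      ≤ (√(a₁ ^ 2 + b₁ ^ 2) + √(a₂ ^ 2 + b₂ ^ 2)) / 2 := by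
  have h1 := Real.sq_sqrt (by positivity : 0 ≤ a₁ ^ 2 + b₁ ^ 2)
  have h2 := Real.sq_sqrt (by positivity : 0 ≤ a₂ ^ 2 + b₂ ^ 2)
  have h3 : a₁ * a₂ + b₁ * b₂ ≤ √(a₁ ^ 2 + b₁ ^ 2) * √(a₂ ^ 2 + b₂ ^ 2) := by
    rw [← Real.sqrt_mul (by positivity)]
    exact Real.le_sqrt_of_sq_le (by nlinarith [sq_nonneg (a₁ * b₂ - a₂ * b₁)])
  rw [Real.sqrt_le_iff]
  exact ⟨by positivity, by nlinarith⟩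

lemma sqrt_sq_walkAvg_add_le (l : List E) (g h : E → ℝ) (x : E) :
    √(walkAvg l g x ^ 2 + walkAvg l h x ^ 2) ≤ walkAvg l (fun y => √(g y ^ 2 + h y ^ 2)) x := by
  induction l generalizing x with
  | nil => exact le_rfl
  | cons v l ih =>
    simp only [walkAvg]
    refine (sqrt_sq_add_sq_midpoint_le _ _ _ _).trans ?_
    linarith [ih (x + v), ih (x - v)]

lemma gaussianProfile_two_point_add_sq {a b m₁ m₂ w₁ w₂ : ℝ} (ha : a ∈ Ioo (0 : ℝ) 1)
    (hb : b ∈ Ioo (0 : ℝ) 1) (h₁ : |a - b| / 2 ≤ m₁) (h₂ : |a - b| / 2 ≤ m₂) :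
    √(gaussianProfile ((a + b) / 2) ^ 2 + ((w₁ + w₂) / 2) ^ 2)
      ≤ (√(gaussianProfile a ^ 2 + (m₁ ^ 2 + w₁ ^ 2))
        + √(gaussianProfile b ^ 2 + (m₂ ^ 2 + w₂ ^ 2))) / 2 := by
  have hs : ((a - b) / 2) ^ 2 = (|a - b| / 2) ^ 2 := by rw [div_pow, div_pow, sq_abs]
  have e₁ : ((a - b) / 2) ^ 2 ≤ m₁ ^ 2 := by rw [hs]; gcongr
  have e₂ : ((a - b) / 2) ^ 2 ≤ m₂ ^ 2 := by rw [hs]; gcongr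
  have h0 := (gaussianProfile_pos ((a + b) / 2)).le
  calc _ ≤ √(((√(gaussianProfile a ^ 2 + ((a - b) / 2) ^ 2)
      + √(gaussianProfile b ^ 2 + ((a - b) / 2) ^ 2)) / 2) ^ 2 + ((w₁ + w₂) / 2) ^ 2) := by
        gcongr
        exact gaussianProfile_two_point ha hb
    _ ≤ _ := sqrt_sq_add_sq_midpoint_le _ _ _ _
    _ ≤ _ := by
        rw [Real.sq_sqrt (by positivity), Real.sq_sqrt (by positivity)]
        gcongr ?_ / 2
        apply add_le_add <;> exact Real.sqrt_le_sqrt (by linarith)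

/-- Bobkov's functional inequality for a walk with independent signs. -/
lemma gaussianProfile_walkAvg_le (l : List E) {h W : E → ℝ} {V : E → E → ℝ}
    (hh : ∀ x, h x ∈ Ioo (0 : ℝ) 1)
    (hV : ∀ v ∈ l, ∀ x, |h (x + (v + v)) - h x| / 2 ≤ V v x)
    (hV' : ∀ v ∈ l, ∀ x, |h (x + -(v + v)) - h x| / 2 ≤ V v x) (hW : ∀ x, 0 ≤ W x) (x : E) :
    √(gaussianProfile (walkAvg l h x) ^ 2 + walkAvg l W x ^ 2)
      ≤ walkAvg l (fun y => √(gaussianProfile (h y) ^ 2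
        + (W y ^ 2 + (l.map fun v => V v y ^ 2).sum))) x := by
  induction l generalizing W x with
  | nil => simp [walkAvg]
  | cons v l ih =>
    have key : ∀ y, √(gaussianProfile (walkAvg l h y) ^ 2
        + (walkAvg l (V v) y ^ 2 + walkAvg l W y ^ 2))
        ≤ walkAvg l (fun y => √(gaussianProfile (h y) ^ 2
        + (W y ^ 2 + ((v :: l).map fun v => V v y ^ 2).sum))) y := fun y => by
      have hm := sqrt_sq_walkAvg_add_le l (V v) W y
      have h1 := ih (W := fun y => √(V v y ^ 2 + W y ^ 2))
        (fun w hw => hV w (List.mem_cons_of_mem _ hw))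
        (fun w hw => hV' w (List.mem_cons_of_mem _ hw)) (fun y => Real.sqrt_nonneg _) y
      have h2 : walkAvg l (V v) y ^ 2 + walkAvg l W y ^ 2
          ≤ walkAvg l (fun y => √(V v y ^ 2 + W y ^ 2)) y ^ 2 := by
        rw [← Real.sq_sqrt (by positivity : 0 ≤ walkAvg l (V v) y ^ 2 + walkAvg l W y ^ 2)]
        gcongr
      refine (Real.sqrt_le_sqrt (by linarith)).trans (h1.trans (walkAvg_mono l (fun z => ?_) y))
      rw [Real.sq_sqrt (by positivity), List.map_cons, List.sum_cons]
      exact Real.sqrt_le_sqrt (by linarith)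
    have e : x + v + -(v + v) = x - v := by abel
    have e' : x - v + (v + v) = x + v := by abel
    have d₁ := abs_walkAvg_add_sub_le l (hV' v List.mem_cons_self) (x + v)
    have d₂ := abs_walkAvg_add_sub_le l (hV v List.mem_cons_self) (x - v)
    rw [e, abs_sub_comm] at d₁
    rw [e'] at d₂
    have := gaussianProfile_two_point_add_sq (w₁ := walkAvg l W (x + v))
      (w₂ := walkAvg l W (x - v)) (walkAvg_mem l hh (x + v)) (walkAvg_mem l hh (x - v)) d₁ d₂
    have k₁ := key (x + v)
    have k₂ := key (x - v)
    simp only [walkAvg]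
    linarith

end Walk

section WalkMeasure

variable {E : Type*} [NormedAddCommGroup E] [MeasurableSpace E] [BorelSpace E]

/-- The law of the endpoint of the walk from the origin whose steps are the members of the list,
each with an independent uniform sign. -/
def walkMeasure : List E → Measure E
  | [] => Measure.dirac 0
  | v :: l => (2⁻¹ : ℝ≥0∞) • ((walkMeasure l).map (· + v) + (walkMeasure l).map (· - v))

instance isProbabilityMeasure_walkMeasure (l : List E) : IsProbabilityMeasure (walkMeasure l) := by
  induction l with
  | nil => exact inferInstanceAs (IsProbabilityMeasure (Measure.dirac 0))
  | cons v l ih =>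
    constructor
    simp only [walkMeasure, Measure.smul_apply, Measure.add_apply, smul_eq_mul]
    rw [Measure.map_apply (measurable_add_const v) .univ,
      Measure.map_apply (measurable_sub_const v) .univ]
    simp only [preimage_univ, measure_univ]
    rw [one_add_one_eq_two, ENNReal.inv_mul_cancel two_ne_zero ENNReal.ofNat_ne_top]

variable [SecondCountableTopology E] {G : Type*} [NormedAddCommGroup G] [NormedSpace ℝ G]

lemma integral_walkMeasure_cons (v : E) (l : List E) {F : E → G} (hF : Continuous F) {C : ℝ}
    (hC : ∀ x, ‖F x‖ ≤ C) :
    ∫ y, F y ∂walkMeasure (v :: l)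
      = (2⁻¹ : ℝ) • (∫ y, F (y + v) ∂walkMeasure l + ∫ y, F (y - v) ∂walkMeasure l) := by
  have hi : ∀ μ : Measure E, IsFiniteMeasure μ → Integrable F μ := fun μ _ =>
    Integrable.of_bound hF.stronglyMeasurable.aestronglyMeasurable C (ae_of_all _ hC)
  rw [walkMeasure, integral_smul_measure, integral_add_measure (hi _ inferInstance)
    (hi _ inferInstance), integral_map (by fun_prop) hF.stronglyMeasurable.aestronglyMeasurable,
    integral_map (by fun_prop) hF.stronglyMeasurable.aestronglyMeasurable]
  simp

lemma integral_walkMeasure (l : List E) {F : E → ℝ} (hF : Continuous F) {C : ℝ}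
    (hC : ∀ x, ‖F x‖ ≤ C) (x : E) : ∫ y, F (x + y) ∂walkMeasure l = walkAvg l F x := by
  induction l generalizing x with
  | nil => simp [walkMeasure, walkAvg]
  | cons v l ih =>
    rw [integral_walkMeasure_cons v l (F := fun y => F (x + y)) (by fun_prop) (fun y => hC _),
      walkAvg, ← ih, ← ih, smul_eq_mul]
    have e1 : ∀ y, x + (y + v) = x + v + y := fun y => by abel
    have e2 : ∀ y, x + (y - v) = x - v + y := fun y => by abel
    simp only [e1, e2]
    ring

end WalkMeasure

section CharFun

variable {E : Type*} [NormedAddCommGroup E] [InnerProductSpace ℝ E] [MeasurableSpace E]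
  [BorelSpace E] [SecondCountableTopology E]

lemma charFun_walkMeasure (l : List E) (t : E) :
    charFun (walkMeasure l) t = ((l.map fun v => Complex.cos (inner ℝ v t)).prod) := by
  induction l with
  | nil => simp [walkMeasure, charFun_dirac]
  | cons v l ih =>
    rw [charFun_apply, integral_walkMeasure_cons v l (by fun_prop) (C := 1)
      (fun x => (Complex.norm_exp_ofReal_mul_I _).le), List.map_cons, List.prod_cons, ← ih,
      charFun_apply]
    have e1 : ∀ y, Complex.exp ((inner ℝ (y + v) t : ℝ) * Complex.I)
        = Complex.exp ((inner ℝ y t : ℝ) * Complex.I)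
          * Complex.exp ((inner ℝ v t : ℝ) * Complex.I) := fun y => by
      rw [inner_add_left, ← Complex.exp_add]; push_cast; ring_nf
    have e2 : ∀ y, Complex.exp ((inner ℝ (y - v) t : ℝ) * Complex.I)
        = Complex.exp ((inner ℝ y t : ℝ) * Complex.I)
          * Complex.exp (-(inner ℝ v t : ℝ) * Complex.I) := fun y => by
      rw [inner_sub_left, ← Complex.exp_add]; push_cast; ring_nf
    simp only [e1, e2]
    rw [integral_mul_const, integral_mul_const, Complex.cos, Complex.real_smul]
    push_cast
    ring

lemma tendsto_cos_inv_sqrt_mul_pow (t : ℝ) :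
    Tendsto (fun N : ℕ => Complex.cos (((√N)⁻¹ * t : ℝ) : ℂ) ^ N) atTop
      (𝓝 (Complex.exp (-(t : ℂ) ^ 2 / 2))) := by
  have hi : ∀ F : ℝ → ℝ, Continuous F → ∀ C : ℝ, (∀ x, ‖F x‖ ≤ C) →
      ∫ y, F y ∂walkMeasure [(1 : ℝ)] = (F 1 + F (-1)) / 2 := fun F hF C hC => by
    have := integral_walkMeasure [(1 : ℝ)] hF hC 0
    simpa [walkAvg] using this
  have hX : Measurable fun x : ℝ => max (-1) (min x 1) := by fun_prop
  have hb : ∀ x : ℝ, ‖max (-1) (min x 1)‖ ≤ 1 := fun x => by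
    rw [Real.norm_eq_abs, abs_le]
    exact ⟨le_max_left _ _, max_le (by norm_num) (min_le_right _ _)⟩
  have h := tendsto_charFun_inv_sqrt_mul_pow (P := walkMeasure [(1 : ℝ)])
    (X := fun x : ℝ => max (-1) (min x 1)) hX.aemeasurable
    (by rw [hi _ (by fun_prop) 1 hb]; norm_num)
    (by
      simp only [Pi.pow_apply]
      rw [hi _ (by fun_prop) 1 (fun x => by
        rw [norm_pow]; exact pow_le_one₀ (norm_nonneg _) (hb x))]
      norm_num) t
  refine h.congr fun N => ?_
  congr 1
  have hmap : (walkMeasure [(1 : ℝ)]).map (fun x : ℝ => max (-1) (min x 1))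
      = walkMeasure [(1 : ℝ)] := by
    have hd : walkMeasure [(1 : ℝ)]
        = (2⁻¹ : ℝ≥0∞) • (Measure.dirac (1 : ℝ) + Measure.dirac (-1 : ℝ)) := by
      simp only [walkMeasure]
      rw [Measure.map_dirac' (measurable_add_const (1 : ℝ)),
        Measure.map_dirac' (measurable_sub_const (1 : ℝ)), zero_add, zero_sub]
    rw [hd, Measure.map_smul, Measure.map_add _ _ hX, Measure.map_dirac' hX, Measure.map_dirac' hX]
    norm_num
  rw [hmap, charFun_walkMeasure]
  simp

/-- The steps of a walk in `ℝⁿ` approximating the standard Gaussian vector. -/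
def gaussianSteps (n N : ℕ) : List (EuclideanSpace ℝ (Fin n)) :=
  (List.finRange n).flatMap fun i => List.replicate N ((√N)⁻¹ • EuclideanSpace.single i (1 : ℝ))

lemma prod_map_gaussianSteps {M : Type*} [CommMonoid M] (n N : ℕ)
    (F : EuclideanSpace ℝ (Fin n) → M) :
    ((gaussianSteps n N).map F).prod = ∏ i, F ((√N)⁻¹ • EuclideanSpace.single i (1 : ℝ)) ^ N := by
  rw [gaussianSteps, List.map_flatMap, List.flatMap_def, List.prod_flatten, List.map_map]
  simp [Function.comp_def, List.prod_replicate, Fin.prod_univ_def]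

lemma sum_map_gaussianSteps (n N : ℕ) (F : EuclideanSpace ℝ (Fin n) → ℝ) :
    ((gaussianSteps n N).map F).sum
      = ∑ i, N * F ((√N)⁻¹ • EuclideanSpace.single i (1 : ℝ)) := by
  rw [gaussianSteps, List.map_flatMap, List.flatMap_def, List.sum_flatten, List.map_map]
  simp [Function.comp_def, List.sum_replicate, Fin.sum_univ_def]

/-- The central limit theorem for the walks with steps `gaussianSteps n N`. -/
lemma tendsto_integral_walkMeasure_gaussianSteps (n : ℕ) {F : EuclideanSpace ℝ (Fin n) → ℝ}
    (hF : Continuous F) {C : ℝ} (hC : ∀ x, ‖F x‖ ≤ C) :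
    Tendsto (fun N => ∫ x, F x ∂walkMeasure (gaussianSteps n N)) atTop
      (𝓝 (∫ x, F x ∂ProbabilityTheory.stdGaussian (EuclideanSpace ℝ (Fin n)))) := by
  let P : ℕ → ProbabilityMeasure (EuclideanSpace ℝ (Fin n)) := fun N =>
    ⟨walkMeasure (gaussianSteps n N), inferInstance⟩
  let P₀ : ProbabilityMeasure (EuclideanSpace ℝ (Fin n)) :=
    ⟨ProbabilityTheory.stdGaussian (EuclideanSpace ℝ (Fin n)), inferInstance⟩
  suffices hP : Tendsto P atTop (𝓝 P₀) from
    ProbabilityMeasure.tendsto_iff_forall_integral_tendsto.1 hP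
      (BoundedContinuousFunction.ofNormedAddCommGroup F hF C hC)
  refine ProbabilityMeasure.tendsto_of_tendsto_charFun fun t => ?_
  change Tendsto (fun N => charFun (walkMeasure (gaussianSteps n N)) t) atTop
    (𝓝 (charFun (ProbabilityTheory.stdGaussian (EuclideanSpace ℝ (Fin n))) t))
  have hc : Complex.exp (-(‖t‖ : ℂ) ^ 2 / 2) = ∏ i, Complex.exp (-((t i : ℝ) : ℂ) ^ 2 / 2) := by
    rw [← Complex.exp_sum, ← Complex.ofReal_pow, EuclideanSpace.real_norm_sq_eq]
    simp [Finset.sum_div, neg_div]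
  rw [charFun_stdGaussian, hc]
  refine (tendsto_finsetProd _ fun i _ => tendsto_cos_inv_sqrt_mul_pow (t i)).congr fun N => ?_
  rw [charFun_walkMeasure, prod_map_gaussianSteps]
  simp [real_inner_smul_left, EuclideanSpace.inner_single_left]

end CharFun

open scoped Convolution in
lemma norm_convolution_sub_le {E : Type*} [NormedAddCommGroup E] [MeasurableSpace E]
    [BorelSpace E] {F : Type*} [NormedAddCommGroup F] [NormedSpace ℝ F]
    {μ : Measure E} [IsFiniteMeasureOnCompacts μ] {f : E → ℝ} (hf : LipschitzWith 1 f)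
    {k : E → F} (hk : Continuous k) (hkc : HasCompactSupport k)
    (B : F →L[ℝ] ℝ →L[ℝ] F) (hB : ∀ a s, ‖B a s‖ ≤ ‖a‖ * ‖s‖) (x y : E) :
    ‖(k ⋆[B, μ] f) x - (k ⋆[B, μ] f) y‖ ≤ (∫ t, ‖k t‖ ∂μ) * ‖x - y‖ := by
  have hi : ∀ z, Integrable (fun t => B (k t) (f (z - t))) μ := fun z => by
    refine Continuous.integrable_of_hasCompactSupport
      (by have := hf.continuous; fun_prop) (hkc.mono fun t ht => ?_)
    rw [Function.mem_support] at ht ⊢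
    contrapose! ht
    simp [ht]
  rw [convolution_def, convolution_def, ← integral_sub (hi x) (hi y), ← integral_mul_const]
  refine norm_integral_le_of_norm_le
    ((hk.norm.integrable_of_hasCompactSupport hkc.norm).mul_const _) (ae_of_all _ fun t => ?_)
  rw [← map_sub]
  have h1 : ‖f (x - t) - f (y - t)‖ ≤ ‖x - y‖ := by
    have := hf.dist_le_mul (x - t) (y - t)
    rw [dist_eq_norm, dist_eq_norm, NNReal.coe_one, one_mul, sub_sub_sub_cancel_right] at this
    exact this
  exact (hB _ _).trans (by gcongr)

/-- A `1`-Lipschitz function is uniformly approximated by differentiable `1`-Lipschitz functions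
with Lipschitz derivative. -/
lemma LipschitzWith.exists_approx_lipschitz_fderiv {E : Type*} [NormedAddCommGroup E]
    [NormedSpace ℝ E] [FiniteDimensional ℝ E] [MeasurableSpace E] [BorelSpace E] {f : E → ℝ}
    (hf : LipschitzWith 1 f) {η : ℝ} (hη : 0 < η) :
    ∃ (g : E → ℝ) (g' : E → E →L[ℝ] ℝ) (L : ℝ≥0), (∀ x, |g x - f x| ≤ η) ∧ LipschitzWith 1 g ∧
      (∀ x, HasFDerivAt g (g' x) x) ∧ LipschitzWith L g' := by
  let μ : Measure E := Measure.addHaar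
  let φ : ContDiffBump (0 : E) := ⟨η / 2, η, half_pos hη, half_lt_self hη⟩
  have hφ1 : ContDiff ℝ 1 (φ.normed μ) := φ.contDiff_normed
  have hφc : HasCompactSupport (φ.normed μ) := φ.hasCompactSupport_normed
  let B := ContinuousLinearMap.lsmul ℝ ℝ (E := ℝ)
  have hB : ∀ a s, ‖B a s‖ ≤ ‖a‖ * ‖s‖ := fun a s => by simp [B]
  let k := fderiv ℝ (φ.normed μ)
  have hk : Continuous k := hφ1.continuous_fderiv one_ne_zero
  have hkc : HasCompactSupport k := hφc.fderiv ℝ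
  have hB' : ∀ u s, ‖B.precompL E u s‖ ≤ ‖u‖ * ‖s‖ := fun u s => by
    refine ContinuousLinearMap.opNorm_le_bound _ (by positivity) fun v => ?_
    rw [ContinuousLinearMap.precompL_apply]
    refine (hB _ _).trans ?_
    rw [mul_right_comm]
    gcongr
    exact u.le_opNorm v
  refine ⟨convolution (φ.normed μ) f B μ, convolution k f (B.precompL E) μ,
    ⟨∫ t, ‖k t‖ ∂μ, by positivity⟩, fun x => ?_, ?_, fun x => ?_, ?_⟩
  · refine φ.dist_normed_convolution_le hf.continuous.aestronglyMeasurable fun y hy => ?_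
    have := hf.dist_le_mul y x
    rw [NNReal.coe_one, one_mul] at this
    exact this.trans (Metric.mem_ball.1 hy).le
  · refine LipschitzWith.of_dist_le_mul fun x y => ?_
    have := norm_convolution_sub_le (μ := μ) hf hφ1.continuous hφc B hB x y
    rw [dist_eq_norm, dist_eq_norm, NNReal.coe_one]
    refine this.trans_eq ?_
    congr 1
    rw [← φ.integral_normed (μ := μ)]
    exact integral_congr_ae (ae_of_all _ fun t => Real.norm_of_nonneg (φ.nonneg_normed t))
  · exact hφc.hasFDerivAt_convolution_left B hφ1 hf.continuous.locallyIntegrable x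
  · refine LipschitzWith.of_dist_le_mul fun x y => ?_
    rw [dist_eq_norm, dist_eq_norm]
    exact norm_convolution_sub_le hf hk hkc _ hB' x y

lemma norm_sub_sub_fderiv_le {E : Type*} [NormedAddCommGroup E] [NormedSpace ℝ E]
    {g : E → ℝ} {g' : E → E →L[ℝ] ℝ} {L : ℝ≥0} (hg : ∀ x, HasFDerivAt g (g' x) x)
    (hL : LipschitzWith L g') (x w : E) :
    ‖g (x + w) - g x - g' x w‖ ≤ L * ‖w‖ ^ 2 := by
  have h := (convex_closedBall x ‖w‖).norm_image_sub_le_of_norm_hasFDerivWithin_le'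
    (f := g) (f' := g') (φ := g' x) (C := L * ‖w‖) (x := x) (y := x + w)
    (fun y _ => (hg y).hasFDerivWithinAt)
    (fun y hy => by
      have := hL.dist_le_mul y x
      rw [dist_eq_norm] at this
      exact this.trans (by gcongr; exact Metric.mem_closedBall.1 hy))
    (Metric.mem_closedBall_self (norm_nonneg _)) (by simp)
  rw [add_sub_cancel_left] at h
  exact h.trans_eq (by ring)

lemma abs_normalCDF_sub_le (a b : ℝ) :
    |normalCDF b - normalCDF a| ≤ normalPDF a * |b - a| + (b - a) ^ 2 := by
  have hlip : ∀ x y, |normalPDF x - normalPDF y| ≤ |x - y| := fun x y => by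
    have := Convex.norm_image_sub_le_of_norm_hasDerivWithin_le (C := 1) (s := univ)
      (fun z _ => (hasDerivAt_normalPDF z).hasDerivWithinAt)
      (fun z _ => by rw [norm_neg]; exact abs_mul_normalPDF_le_one z) convex_univ
      (mem_univ y) (mem_univ x)
    simpa using this
  have hd : ∀ z, HasDerivAt (fun z => normalCDF z - normalPDF a * z)
      (normalPDF z - normalPDF a) z := fun z => by
    refine ((hasDerivAt_normalCDF z).sub ((hasDerivAt_id z).const_mul (normalPDF a))).congr_deriv ?_
    simp
  have h := Convex.norm_image_sub_le_of_norm_hasDerivWithin_le (C := |b - a|) (s := uIcc a b)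
    (fun z _ => (hd z).hasDerivWithinAt)
    (fun z hz => (hlip z a).trans (abs_sub_left_of_mem_uIcc hz)) (convex_uIcc a b)
    left_mem_uIcc right_mem_uIcc
  rw [Real.norm_eq_abs, Real.norm_eq_abs, ← sq, sq_abs] at h
  have e : normalCDF b - normalCDF a
      = (normalCDF b - normalPDF a * b - (normalCDF a - normalPDF a * a))
        + normalPDF a * (b - a) := by ring
  rw [e]
  refine (abs_add_le _ _).trans ?_
  rw [abs_mul, abs_of_pos (normalPDF_pos a)]
  linarith

lemma integral_mem_Ioo {Ω : Type*} [MeasurableSpace Ω] {μ : Measure Ω} [IsProbabilityMeasure μ]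
    {h : Ω → ℝ} (hm : AEStronglyMeasurable h μ) (hh : ∀ x, h x ∈ Ioo (0 : ℝ) 1) :
    ∫ x, h x ∂μ ∈ Ioo (0 : ℝ) 1 := by
  have hi : Integrable h μ := Integrable.of_bound hm 1 (ae_of_all _ fun x => by
    rw [Real.norm_of_nonneg (hh x).1.le]; exact (hh x).2.le)
  have key : ∀ g : Ω → ℝ, Integrable g μ → (∀ x, 0 < g x) → 0 < ∫ x, g x ∂μ := fun g hg hpos => by
    rw [integral_pos_iff_support_of_nonneg (fun x => (hpos x).le) hg]
    have : Function.support g = univ := eq_univ_of_forall fun x => (hpos x).ne'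
    simp [this]
  refine ⟨key h hi fun x => (hh x).1, ?_⟩
  have := key (fun x => 1 - h x) ((integrable_const 1).sub hi) fun x => sub_pos.2 (hh x).2
  rw [integral_sub (integrable_const 1) hi] at this
  simp at this
  linarith

lemma sum_sq_apply_single {n : ℕ} (T : EuclideanSpace ℝ (Fin n) →L[ℝ] ℝ) :
    ∑ i, |T (EuclideanSpace.single i 1)| ^ 2 = ‖T‖ ^ 2 := by
  have := (EuclideanSpace.basisFun (Fin n) ℝ).norm_dual T
  rw [this]
  simp

/-- Bobkov's functional inequality for the standard Gaussian measure. -/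
lemma gaussianProfile_integral_normalCDF_le {n : ℕ} {k : EuclideanSpace ℝ (Fin n) → ℝ}
    {k' : EuclideanSpace ℝ (Fin n) → EuclideanSpace ℝ (Fin n) →L[ℝ] ℝ} {κ L : ℝ≥0}
    (hk : LipschitzWith κ k) (hk' : ∀ x, HasFDerivAt k (k' x) x) (hL : LipschitzWith L k') :
    gaussianProfile (∫ x, normalCDF (k x) ∂ProbabilityTheory.stdGaussian _)
      ≤ √(1 + κ ^ 2) * ∫ x, normalPDF (k x) ∂ProbabilityTheory.stdGaussian _ := by
  have hkcont := hk.continuous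
  have hC := continuous_normalCDF
  have hP := continuous_normalPDF
  have hCb : ∀ x, ‖normalCDF (k x)‖ ≤ 1 := fun x => by
    rw [Real.norm_of_nonneg (normalCDF_mem _).1.le]; exact (normalCDF_mem _).2.le
  have hκ : ∀ x, ‖k' x‖ ≤ κ := fun x => (hk' x).le_of_lipschitz hk
  set K : ℝ := L + κ ^ 2 with hK
  have hK0 : 0 ≤ K := by positivity
  have hstep : ∀ x w, |normalCDF (k (x + w)) - normalCDF (k x)|
      ≤ normalPDF (k x) * |k' x w| + K * ‖w‖ ^ 2 := fun x w => by
    have h1 := abs_normalCDF_sub_le (k x) (k (x + w))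
    have h2 := norm_sub_sub_fderiv_le hk' hL x w
    rw [Real.norm_eq_abs] at h2
    have h3 : |k (x + w) - k x| ≤ |k' x w| + L * ‖w‖ ^ 2 := by
      have := abs_add_le (k (x + w) - k x - k' x w) (k' x w)
      rw [sub_add_cancel] at this
      linarith
    have h4 : |k (x + w) - k x| ≤ κ * ‖w‖ := by
      have := hk.dist_le_mul (x + w) x
      rwa [dist_eq_norm, dist_eq_norm, add_sub_cancel_left] at this
    have h5 : (k (x + w) - k x) ^ 2 ≤ κ ^ 2 * ‖w‖ ^ 2 := by
      rw [← sq_abs, ← mul_pow]; gcongr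
    have h6 := mul_le_mul_of_nonneg_left h3 (normalPDF_pos (k x)).le
    have h7 : normalPDF (k x) * (L * ‖w‖ ^ 2) ≤ 1 * (L * ‖w‖ ^ 2) := by
      gcongr; exact normalPDF_le_one _
    rw [hK]
    nlinarith
  let V : EuclideanSpace ℝ (Fin n) → EuclideanSpace ℝ (Fin n) → ℝ := fun v x =>
    normalPDF (k x) * |k' x v| + 2 * K * ‖v‖ ^ 2
  let R : ℕ → ℝ := fun N => n * (4 * K * κ * (√N)⁻¹ + 4 * K ^ 2 * (√N)⁻¹ ^ 2)
  have hVsum : ∀ N : ℕ, 0 < N → ∀ x, ((gaussianSteps n N).map fun v => V v x ^ 2).sum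
      ≤ normalPDF (k x) ^ 2 * κ ^ 2 + R N := fun N hN x => by
    have hN' : (0 : ℝ) < √N := Real.sqrt_pos.2 (Nat.cast_pos.2 hN)
    rw [sum_map_gaussianSteps]
    have hterm : ∀ i : Fin n, (N : ℝ) * V ((√N)⁻¹ • EuclideanSpace.single i 1) x ^ 2
        ≤ normalPDF (k x) ^ 2 * |k' x (EuclideanSpace.single i 1)| ^ 2
          + (4 * K * κ * (√N)⁻¹ + 4 * K ^ 2 * (√N)⁻¹ ^ 2) := fun i => by
      have hnorm : |k' x (EuclideanSpace.single i 1)| ≤ κ := by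
        refine ((k' x).le_opNorm _).trans ?_
        simpa using hκ x
      have hpn := normalPDF_pos (k x)
      have hp1 := normalPDF_le_one (k x)
      have hprod : normalPDF (k x) * |k' x (EuclideanSpace.single i 1)| ≤ 1 * κ := by gcongr
      simp only [V, map_smul, smul_eq_mul, abs_mul, norm_smul, PiLp.norm_single, norm_one,
        mul_one, Real.norm_eq_abs, abs_of_pos (inv_pos.2 hN')]
      have hNs : (N : ℝ) = √N ^ 2 := (Real.sq_sqrt (Nat.cast_nonneg N)).symm
      have e : (N : ℝ) * (normalPDF (k x) * ((√N)⁻¹ * |k' x (EuclideanSpace.single i 1)|)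
          + 2 * K * (√N)⁻¹ ^ 2) ^ 2
          = (normalPDF (k x) * |k' x (EuclideanSpace.single i 1)| + 2 * K * (√N)⁻¹) ^ 2 := by
        rw [hNs, Real.sqrt_sq hN'.le, ← mul_pow]
        congr 1
        field_simp
      rw [e]
      have hKN : 0 ≤ 4 * K * (√N)⁻¹ := by positivity
      nlinarith [mul_le_mul_of_nonneg_right hprod hKN]
    refine (Finset.sum_le_sum fun i _ => hterm i).trans ?_
    rw [Finset.sum_add_distrib, ← Finset.mul_sum, sum_sq_apply_single]
    simp only [Finset.sum_const, Finset.card_univ, Fintype.card_fin, nsmul_eq_mul]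
    gcongr
    exact hκ x
  have hwalk : ∀ N : ℕ, 0 < N →
      gaussianProfile (∫ x, normalCDF (k x) ∂walkMeasure (gaussianSteps n N))
        ≤ √(1 + κ ^ 2) * ∫ x, normalPDF (k x) ∂walkMeasure (gaussianSteps n N) + √(R N) := by
    intro N hN
    have hR : 0 ≤ R N := by positivity
    have hb := gaussianProfile_walkAvg_le (gaussianSteps n N) (h := fun x => normalCDF (k x))
      (W := fun _ => 0) (V := V) (fun x => normalCDF_mem _)
      (fun v _ x => by
        have := hstep x (v + v)
        rw [map_add, ← two_mul, abs_mul, abs_two, ← two_smul ℝ v, norm_smul, Real.norm_two] at this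
        simp only [V, ← two_smul ℝ v]
        linarith)
      (fun v _ x => by
        have := hstep x (-(v + v))
        rw [map_neg, abs_neg, norm_neg, map_add, ← two_mul, abs_mul, abs_two, ← two_smul ℝ v,
          norm_smul, Real.norm_two] at this
        simp only [V, ← two_smul ℝ v]
        linarith)
      (fun _ => le_rfl) 0
    have hpt : ∀ x, √(gaussianProfile (normalCDF (k x)) ^ 2
        + ((0 : ℝ) ^ 2 + ((gaussianSteps n N).map fun v => V v x ^ 2).sum))
        ≤ √(1 + κ ^ 2) * normalPDF (k x) + √(R N) := fun x => by
      rw [gaussianProfile_normalCDF]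
      have hp := normalPDF_pos (k x)
      rw [Real.sqrt_le_iff]
      refine ⟨by positivity, ?_⟩
      have e1 := Real.sq_sqrt (by positivity : (0 : ℝ) ≤ 1 + κ ^ 2)
      have e2 := Real.sq_sqrt hR
      have e3 : 0 ≤ √(1 + κ ^ 2) * normalPDF (k x) * √(R N) := by positivity
      have := hVsum N hN x
      calc _ ≤ normalPDF (k x) ^ 2 * (1 + κ ^ 2) + R N := by linarith
        _ = normalPDF (k x) ^ 2 * √(1 + κ ^ 2) ^ 2 + √(R N) ^ 2 := by rw [e1, e2]
        _ ≤ _ := by nlinarith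
    have hb2 := (Real.le_sqrt_of_sq_le (le_add_of_nonneg_right (sq_nonneg _))).trans
      (hb.trans (walkAvg_mono _ hpt 0))
    have hPb : ∀ x, ‖√(1 + κ ^ 2) * normalPDF (k x) + √(R N)‖ ≤ √(1 + κ ^ 2) * 1 + √(R N) :=
      fun x => by
        have hp := normalPDF_pos (k x)
        rw [Real.norm_of_nonneg (by positivity)]
        gcongr
        exact normalPDF_le_one _
    rw [← integral_walkMeasure _ (by fun_prop) hCb,
      ← integral_walkMeasure _ (by fun_prop) hPb] at hb2
    simp only [zero_add] at hb2
    refine hb2.trans_eq ?_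
    rw [integral_add _ (integrable_const _), integral_const_mul]
    · simp
    · refine (Integrable.of_bound (by fun_prop) 1 (ae_of_all _ fun x => ?_)).const_mul _
      rw [Real.norm_of_nonneg (normalPDF_pos _).le]; exact normalPDF_le_one _
  have hlimC := tendsto_integral_walkMeasure_gaussianSteps n
    (F := fun x => normalCDF (k x)) (by fun_prop) hCb
  have hlimP := tendsto_integral_walkMeasure_gaussianSteps n
    (F := fun x => normalPDF (k x)) (by fun_prop) (C := 1) (fun x => by
      rw [Real.norm_of_nonneg (normalPDF_pos _).le]; exact normalPDF_le_one _)
  have hδ : Tendsto (fun N : ℕ => (√(N : ℝ))⁻¹) atTop (𝓝 0) :=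
    (Real.tendsto_sqrt_atTop.comp tendsto_natCast_atTop_atTop).inv_tendsto_atTop
  have hlimR : Tendsto (fun N => √(R N)) atTop (𝓝 0) := by
    have : Tendsto R atTop (𝓝 (n * (4 * K * κ * 0 + 4 * K ^ 2 * 0 ^ 2))) :=
      ((hδ.const_mul _).add ((hδ.pow 2).const_mul _)).const_mul _
    have h2 := (Real.continuous_sqrt.tendsto _).comp this
    simpa [Function.comp_def] using h2
  have hmem := integral_mem_Ioo (μ := ProbabilityTheory.stdGaussian (EuclideanSpace ℝ (Fin n)))
    (h := fun x => normalCDF (k x)) (by fun_prop) (fun x => normalCDF_mem _)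
  refine le_of_tendsto_of_tendsto ((continuousAt_gaussianProfile hmem).tendsto.comp hlimC)
    (b := atTop) (g := fun N => √(1 + κ ^ 2) *
      ∫ x, normalPDF (k x) ∂walkMeasure (gaussianSteps n N) + √(R N)) ?_ ?_
  · simpa using (hlimP.const_mul (√(1 + κ ^ 2))).add hlimR
  · filter_upwards [eventually_gt_atTop 0] with N hN using hwalk N hN

lemma integral_normalCDF_mem {Ω : Type*} [MeasurableSpace Ω] {μ : Measure Ω}
    [IsProbabilityMeasure μ] {k : Ω → ℝ} (hk : Measurable k) :
    ∫ x, normalCDF (k x) ∂μ ∈ Ioo (0 : ℝ) 1 :=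
  integral_mem_Ioo (continuous_normalCDF.measurable.comp hk).aestronglyMeasurable
    fun _ => normalCDF_mem _

lemma integrable_normalCDF_comp {Ω : Type*} [MeasurableSpace Ω] {μ : Measure Ω}
    [IsProbabilityMeasure μ] {k : Ω → ℝ} (hk : Measurable k) :
    Integrable (fun x => normalCDF (k x)) μ :=
  Integrable.of_bound (continuous_normalCDF.measurable.comp hk).aestronglyMeasurable 1
    (ae_of_all _ fun x => by
      rw [Real.norm_of_nonneg (normalCDF_mem _).1.le]; exact (normalCDF_mem _).2.le)

lemma hasDerivAt_integral_normalCDF_mul_sub {Ω : Type*} [MeasurableSpace Ω] {μ : Measure Ω}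
    [IsProbabilityMeasure μ] {g : Ω → ℝ} (hg : Measurable g) {κ : ℝ} (hκ : 0 ≤ κ) (r : ℝ) :
    HasDerivAt (fun r => ∫ x, normalCDF (κ * (r - g x)) ∂μ)
      (κ * ∫ x, normalPDF (κ * (r - g x)) ∂μ) r := by
  have hP := continuous_normalPDF.measurable
  rw [← integral_const_mul]
  refine (hasDerivAt_integral_of_dominated_loc_of_deriv_le (s := univ) (bound := fun _ => κ)
    (F := fun r x => normalCDF (κ * (r - g x)))
    (F' := fun r x => κ * normalPDF (κ * (r - g x))) univ_mem
    (Eventually.of_forall fun r => (integrable_normalCDF_comp (by fun_prop)).1)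
    (integrable_normalCDF_comp (by fun_prop))
    ((hP.comp (by fun_prop)).const_mul κ).aestronglyMeasurable
    (ae_of_all _ fun x r _ => ?_) (integrable_const _) (ae_of_all _ fun x r _ => ?_)).2
  · have := normalPDF_pos (κ * (r - g x))
    rw [Real.norm_of_nonneg (by positivity)]
    exact mul_le_of_le_one_right hκ (normalPDF_le_one _)
  · refine ((hasDerivAt_normalCDF (κ * (r - g x))).comp r
      (((hasDerivAt_id r).sub_const (g x)).const_mul κ)).congr_deriv ?_
    simp [mul_comm]

/-- The smoothed distribution function of a smooth `1`-Lipschitz function, transported by `probit`,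
grows at least linearly. -/
lemma monotone_probit_integral_normalCDF_sub {n : ℕ} {g : EuclideanSpace ℝ (Fin n) → ℝ}
    {g' : EuclideanSpace ℝ (Fin n) → EuclideanSpace ℝ (Fin n) →L[ℝ] ℝ} {L : ℝ≥0}
    (hg : LipschitzWith 1 g) (hg' : ∀ x, HasFDerivAt g (g' x) x) (hL : LipschitzWith L g')
    (κ : ℝ≥0) :
    Monotone fun r : ℝ =>
      probit (∫ x, normalCDF (κ * (r - g x)) ∂ProbabilityTheory.stdGaussian _)
        - κ / √(1 + κ ^ 2) * r := by
  have hgm : Measurable g := hg.continuous.measurable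
  have hmem := fun r : ℝ => integral_normalCDF_mem
    (μ := ProbabilityTheory.stdGaussian (EuclideanSpace ℝ (Fin n)))
    (k := fun x => κ * (r - g x)) (by fun_prop)
  refine monotone_of_hasDerivAt_nonneg (fun r =>
    ((hasDerivAt_probit (hmem r)).comp r
      (hasDerivAt_integral_normalCDF_mul_sub hgm κ.coe_nonneg r)).sub
      ((hasDerivAt_id r).const_mul _)) fun r => ?_
  have hk : LipschitzWith κ fun x => κ * (r - g x) := by
    refine LipschitzWith.of_dist_le_mul fun x y => ?_
    have := hg.dist_le_mul x y
    rw [NNReal.coe_one, one_mul, Real.dist_eq] at this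
    rw [Real.dist_eq, ← mul_sub, abs_mul, NNReal.abs_eq, sub_sub_sub_cancel_left, abs_sub_comm]
    gcongr
  have hk' : ∀ x, HasFDerivAt (fun x => κ * (r - g x)) ((-κ : ℝ) • g' x) x := fun x => by
    refine (((hg' x).const_sub r).const_mul (κ : ℝ)).congr_fderiv ?_
    ext v
    simp
  have hL' : LipschitzWith (κ * L) fun x => (-κ : ℝ) • g' x := by
    refine LipschitzWith.of_dist_le_mul fun x y => ?_
    have e : (-κ : ℝ) • g' x - (-κ : ℝ) • g' y = (-κ : ℝ) • (g' x - g' y) := by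
      ext v
      simp
      ring
    rw [dist_eq_norm, e]
    refine (ContinuousLinearMap.opNorm_smul_le _ _).trans ?_
    rw [norm_neg, Real.norm_of_nonneg κ.coe_nonneg, NNReal.coe_mul, mul_assoc, ← dist_eq_norm]
    gcongr
    exact hL.dist_le_mul x y
  have hb := gaussianProfile_integral_normalCDF_le hk hk' hL'
  have hI := gaussianProfile_pos (∫ x, normalCDF (κ * (r - g x))
    ∂ProbabilityTheory.stdGaussian _)
  simp only [Pi.zero_apply, mul_one, sub_nonneg]
  rw [show normalPDF (probit (∫ x, normalCDF (κ * (r - g x))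
    ∂ProbabilityTheory.stdGaussian _)) = gaussianProfile (∫ x, normalCDF (κ * (r - g x))
    ∂ProbabilityTheory.stdGaussian _) from rfl, inv_mul_eq_div,
    div_le_div_iff₀ (by positivity) hI]
  calc _ ≤ (κ : ℝ) * (√(1 + κ ^ 2) * ∫ x, normalPDF (κ * (r - g x))
        ∂ProbabilityTheory.stdGaussian _) := by gcongr
    _ = _ := by rw [← mul_assoc, mul_comm (κ : ℝ), mul_assoc, mul_comm]

lemma normalCDF_sub_le_measureReal_le_add {n : ℕ} {f : EuclideanSpace ℝ (Fin n) → ℝ}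
    (hf : LipschitzWith 1 f) {M : ℝ}
    (hM : (1 : ℝ) / 2 ≤ (ProbabilityTheory.stdGaussian _).real {x | f x ≤ M})
    {s θ : ℝ} (hθ : 0 < θ) (hs : M + θ ≤ s) :
    normalCDF (s - M - θ) ≤ (ProbabilityTheory.stdGaussian _).real {x | f x ≤ s + θ} := by
  obtain ⟨g, g', L, hgf, hg, hg', hL⟩ := hf.exists_approx_lipschitz_fderiv (half_pos hθ)
  set γ := ProbabilityTheory.stdGaussian (EuclideanSpace ℝ (Fin n))
  have hgm : Measurable g := hg.continuous.measurable
  have hset : ∀ a, MeasurableSet {x | f x ≤ a} := fun a =>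
    measurableSet_le hf.continuous.measurable measurable_const
  have hmono := strictMono_normalCDF.monotone
  have hi : ∀ (κ : ℝ≥0) (r : ℝ), Integrable (fun x => normalCDF (κ * (r - g x))) γ :=
    fun κ r => integrable_normalCDF_comp (by fun_prop)
  have hlow : ∀ κ : ℝ≥0, 1 / 2 * normalCDF (κ * (θ / 2))
      ≤ ∫ x, normalCDF (κ * (M + θ - g x)) ∂γ := fun κ => by
    calc _ ≤ γ.real {x | f x ≤ M} * normalCDF (κ * (θ / 2)) := by
          gcongr; exact (normalCDF_mem _).1.le
      _ = ∫ x, {x | f x ≤ M}.indicator (fun _ => normalCDF (κ * (θ / 2))) x ∂γ := by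
          rw [integral_indicator_const _ (hset M), smul_eq_mul]
      _ ≤ _ := by
          refine integral_mono ((integrable_const _).indicator (hset M)) (hi _ _) fun x => ?_
          by_cases hx : f x ≤ M
          · rw [indicator_of_mem (s := {x | f x ≤ M}) hx]
            have := (abs_le.1 (hgf x)).2
            refine hmono (mul_le_mul_of_nonneg_left ?_ κ.coe_nonneg)
            linarith
          · rw [indicator_of_notMem (s := {x | f x ≤ M}) hx]
            exact (normalCDF_mem _).1.le
  have hup : ∀ κ : ℝ≥0, ∫ x, normalCDF (κ * (s - g x)) ∂γ
      ≤ γ.real {x | f x ≤ s + θ} + normalCDF (-(κ * (θ / 2))) := fun κ => by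
    calc _ ≤ ∫ x, ({x | f x ≤ s + θ}.indicator (fun _ => (1 : ℝ)) x
            + normalCDF (-(κ * (θ / 2)))) ∂γ := by
          refine integral_mono (hi _ _)
            (((integrable_const _).indicator (hset _)).add (integrable_const _)) fun x => ?_
          by_cases hx : f x ≤ s + θ
          · rw [indicator_of_mem (s := {x | f x ≤ s + θ}) hx]
            linarith [(normalCDF_mem (κ * (s - g x))).2, (normalCDF_mem (-(κ * (θ / 2)))).1]
          · rw [indicator_of_notMem (s := {x | f x ≤ s + θ}) hx, zero_add, ← mul_neg]
            have := (abs_le.1 (hgf x)).1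
            refine hmono (mul_le_mul_of_nonneg_left ?_ κ.coe_nonneg)
            linarith
      _ = _ := by
          rw [integral_add ((integrable_const _).indicator (hset _)) (integrable_const _),
            integral_indicator_const _ (hset _)]
          simp
  have key : ∀ κ : ℝ≥0, normalCDF (probit (1 / 2 * normalCDF (κ * (θ / 2)))
      + κ / √(1 + κ ^ 2) * (s - M - θ))
      ≤ γ.real {x | f x ≤ s + θ} + normalCDF (-(κ * (θ / 2))) := fun κ => by
    refine le_trans ?_ (hup κ)
    have hmem := fun r : ℝ => integral_normalCDF_mem (μ := γ)
      (k := fun x => κ * (r - g x)) (by fun_prop)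
    rw [← normalCDF_probit (hmem s)]
    refine hmono ?_
    have h1 := monotone_probit_integral_normalCDF_sub hg hg' hL κ hs
    have hc := normalCDF_mem (κ * (θ / 2))
    have h2 := probit_le_probit ⟨by linarith [hc.1], by linarith [hc.2]⟩ (hmem (M + θ)) (hlow κ)
    simp only at h1
    linarith
  have hN : Tendsto (fun N : ℕ => (((N : ℝ≥0) : ℝ)) * (θ / 2)) atTop atTop :=
    (by simpa using tendsto_natCast_atTop_atTop :
      Tendsto (fun N : ℕ => ((N : ℝ≥0) : ℝ)) atTop atTop).atTop_mul_const (half_pos hθ)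
  have hr : Tendsto (fun N : ℕ => ((N : ℝ≥0) : ℝ) / √(1 + ((N : ℝ≥0) : ℝ) ^ 2)) atTop (𝓝 1) := by
    have h1 : Tendsto (fun N : ℕ => (√(((N : ℝ)⁻¹) ^ 2 + 1))⁻¹) atTop (𝓝 (√(0 ^ 2 + 1))⁻¹) :=
      ((Real.continuous_sqrt.tendsto _).comp
        ((tendsto_inv_atTop_nhds_zero_nat.pow 2).add_const 1)).inv₀ (by simp)
    simp only [ne_eq, OfNat.ofNat_ne_zero, not_false_eq_true, zero_pow, zero_add, Real.sqrt_one,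
      inv_one] at h1
    refine h1.congr' ?_
    filter_upwards [eventually_gt_atTop 0] with N hN
    have hN' : (0 : ℝ) < N := Nat.cast_pos.2 hN
    have : ((N : ℝ)⁻¹) ^ 2 + 1 = (1 + (N : ℝ) ^ 2) / N ^ 2 := by field_simp
    rw [this, Real.sqrt_div (by positivity), Real.sqrt_sq hN'.le, inv_div, NNReal.coe_natCast]
  have hp : Tendsto (fun N : ℕ => probit (1 / 2 * normalCDF (((N : ℝ≥0) : ℝ) * (θ / 2)))) atTop
      (𝓝 0) := by
    rw [← probit_half]
    refine (hasDerivAt_probit (p := 1 / 2) ⟨by norm_num, by norm_num⟩).continuousAt.tendsto.comp ?_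
    simpa using (tendsto_normalCDF_atTop.comp hN).const_mul (1 / 2 : ℝ)
  have hl := (continuous_normalCDF.tendsto _).comp (hp.add (hr.mul_const (s - M - θ)))
  have hu := (tendsto_normalCDF_atBot.comp (tendsto_neg_atTop_atBot.comp hN)).const_add
    (γ.real {x | f x ≤ s + θ})
  rw [zero_add, one_mul] at hl
  rw [add_zero] at hu
  exact le_of_tendsto_of_tendsto' hl hu fun N => key N

/-- Gaussian concentration for Lipschitz functions. -/
lemma normalCDF_le_measureReal_le_add {n : ℕ} {f : EuclideanSpace ℝ (Fin n) → ℝ}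
    (hf : LipschitzWith 1 f) {M : ℝ}
    (hM : (1 : ℝ) / 2 ≤ (ProbabilityTheory.stdGaussian _).real {x | f x ≤ M})
    {t : ℝ} (ht : 0 < t) :
    normalCDF t ≤ (ProbabilityTheory.stdGaussian _).real {x | f x ≤ M + t} := by
  have h : Tendsto (fun θ : ℝ => normalCDF (t - 2 * θ)) (𝓝[>] 0) (𝓝 (normalCDF t)) := by
    have : Continuous fun θ : ℝ => normalCDF (t - 2 * θ) :=
      continuous_normalCDF.comp (by fun_prop)
    simpa using (this.tendsto 0).mono_left nhdsWithin_le_nhds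
  refine le_of_tendsto h ?_
  filter_upwards [Ioo_mem_nhdsGT (half_pos ht)] with θ hθ
  have := normalCDF_sub_le_measureReal_le_add hf hM (s := M + t - θ) hθ.1 (by linarith [hθ.2])
  rw [sub_add_cancel] at this
  rwa [show t - 2 * θ = M + t - θ - M - θ by ring]

lemma lintegral_exp_mul_gaussianReal (t : ℝ) :
    ∫⁻ z, ENNReal.ofReal (rexp (t * z)) ∂gaussianReal 0 1 = ENNReal.ofReal (rexp (t ^ 2 / 2)) := by
  rw [← ofReal_integral_eq_lintegral_ofReal (integrable_exp_mul_gaussianReal t)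
    (ae_of_all _ fun z => (Real.exp_pos _).le)]
  have := congrFun (mgf_id_gaussianReal (μ := 0) (v := 1)) t
  simp only [mgf, id, zero_mul, zero_add, NNReal.coe_one, one_mul] at this
  rw [this]

lemma lintegral_exp_mul_add_sq_gaussianReal (a : ℝ) {l : ℝ} (hl : l < 1) :
    ∫⁻ z, ENNReal.ofReal (rexp (a * z + l * z ^ 2 / 2)) ∂gaussianReal 0 1
      = ENNReal.ofReal (1 / √(1 - l) * rexp (a ^ 2 / (2 * (1 - l)))) := by
  have hl' : 0 < 1 - l := sub_pos.2 hl
  let v : ℝ≥0 := ⟨(1 - l)⁻¹, (inv_pos.2 hl').le⟩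
  have hv : v ≠ 0 := fun h => (inv_pos.2 hl').ne' (congrArg NNReal.toReal h)
  have hvc : (v : ℝ) = (1 - l)⁻¹ := rfl
  rw [gaussianReal_of_var_ne_zero 0 one_ne_zero, lintegral_withDensity_eq_lintegral_mul _
    (measurable_gaussianPDF _ _) (by fun_prop)]
  have e : ∀ z, (gaussianPDF 0 1 * fun z => ENNReal.ofReal (rexp (a * z + l * z ^ 2 / 2))) z
      = ENNReal.ofReal (1 / √(1 - l) * rexp (a ^ 2 / (2 * (1 - l))))
        * gaussianPDF (a / (1 - l)) v z := fun z => by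
    rw [Pi.mul_apply, gaussianPDF, gaussianPDF, ← ENNReal.ofReal_mul (gaussianPDFReal_nonneg _ _ _),
      ← ENNReal.ofReal_mul (by positivity), gaussianPDFReal, gaussianPDFReal, hvc,
      Real.sqrt_mul (by positivity) ((1 - l)⁻¹), Real.sqrt_inv]
    congr 1
    rw [NNReal.coe_one, mul_one, mul_assoc, ← Real.exp_add]
    have h1 : 0 < √(1 - l) := Real.sqrt_pos.2 hl'
    have h2 : 0 < √(2 * π) := by positivity
    have e1 : 1 / √(1 - l) * rexp (a ^ 2 / (2 * (1 - l))) * ((√(2 * π) * (√(1 - l))⁻¹)⁻¹ *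
        rexp (-(z - a / (1 - l)) ^ 2 / (2 * (1 - l)⁻¹)))
        = (√(2 * π))⁻¹ * rexp (a ^ 2 / (2 * (1 - l)) +
          -(z - a / (1 - l)) ^ 2 / (2 * (1 - l)⁻¹)) := by
      rw [Real.exp_add]
      field_simp
    rw [e1]
    congr 2
    field_simp
    ring
  rw [lintegral_congr e, lintegral_const_mul _ (measurable_gaussianPDF _ _),
    lintegral_gaussianPDF_eq_one _ hv, mul_one]

/-- Exponential moments increase under domination of the upper tails. -/
lemma lintegral_exp_mul_sub_one_le {Ω Ω' : Type*} [MeasurableSpace Ω] [MeasurableSpace Ω']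
    {μ : Measure Ω} {ν : Measure Ω'} {X : Ω → ℝ} {Y : Ω' → ℝ} (hX : Measurable X)
    (hY : Measurable Y) (hX0 : ∀ x, 0 ≤ X x) (hY0 : ∀ y, 0 ≤ Y y)
    (h : ∀ s > 0, μ {x | s < X x} ≤ ν {y | s < Y y}) {t : ℝ} (ht : 0 ≤ t) :
    ∫⁻ x, ENNReal.ofReal (rexp (t * X x) - 1) ∂μ
      ≤ ∫⁻ y, ENNReal.ofReal (rexp (t * Y y) - 1) ∂ν := by
  have hint : ∀ a b : ℝ, IntervalIntegrable (fun s => t * rexp (t * s)) volume a b := fun a b =>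
    Continuous.intervalIntegrable (by fun_prop) a b
  have e : ∀ a, rexp (t * a) - 1 = ∫ s in (0 : ℝ)..a, t * rexp (t * s) := fun a => by
    rw [intervalIntegral.integral_eq_sub_of_hasDerivAt (f := fun s => rexp (t * s))
      (fun s _ => ?_) (hint _ _)]
    · simp
    · refine ((hasDerivAt_id s).const_mul t).exp.congr_deriv ?_
      simp [mul_comm]
  have hn : ∀ᵐ s ∂volume.restrict (Ioi (0 : ℝ)), 0 ≤ t * rexp (t * s) :=
    ae_of_all _ fun s => by positivity
  simp only [e]
  rw [lintegral_comp_eq_lintegral_meas_lt_mul μ (ae_of_all _ hX0) hX.aemeasurable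
      (fun _ _ => hint _ _) hn,
    lintegral_comp_eq_lintegral_meas_lt_mul ν (ae_of_all _ hY0) hY.aemeasurable
      (fun _ _ => hint _ _) hn]
  refine setLIntegral_mono' measurableSet_Ioi fun s hs => ?_
  gcongr
  exact h s hs

lemma lintegral_exp_mul_sub_le {n : ℕ} {f : EuclideanSpace ℝ (Fin n) → ℝ}
    (hf : LipschitzWith 1 f) {M : ℝ}
    (hM : (1 : ℝ) / 2 ≤ (ProbabilityTheory.stdGaussian _).real {x | f x ≤ M})
    {t : ℝ} (ht : 0 ≤ t) :
    ∫⁻ x, ENNReal.ofReal (rexp (t * (f x - M))) ∂ProbabilityTheory.stdGaussian _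
      ≤ ENNReal.ofReal (2 * rexp (t ^ 2 / 2)) := by
  set γ := ProbabilityTheory.stdGaussian (EuclideanSpace ℝ (Fin n))
  have hfm : Measurable f := hf.continuous.measurable
  have htail : ∀ s > 0, γ {x | s < max (f x - M) 0} ≤ gaussianReal 0 1 {y | s < max y 0} := by
    intro s hs
    have e1 : {x | s < max (f x - M) 0} = {x | f x ≤ M + s}ᶜ := by
      ext x
      simp only [mem_ofPred_eq, mem_compl_iff, lt_max_iff, hs.not_gt, or_false, not_le]
      exact lt_sub_iff_add_lt'
    have e2 : {y : ℝ | s < max y 0} = (Iic s)ᶜ := by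
      ext y
      simp [hs.not_gt]
    rw [e1, e2, ← ENNReal.toReal_le_toReal (measure_ne_top _ _) (measure_ne_top _ _)]
    change γ.real _ ≤ (gaussianReal 0 1).real _
    rw [probReal_compl_eq_one_sub (measurableSet_le hfm measurable_const),
      probReal_compl_eq_one_sub measurableSet_Iic, ← cdf_eq_real]
    exact sub_le_sub_left (normalCDF_le_measureReal_le_add hf hM hs) 1
  have h1 := lintegral_exp_mul_sub_one_le (μ := γ) (ν := gaussianReal 0 1)
    (X := fun x => max (f x - M) 0) (Y := fun y => max y 0) (by fun_prop) (by fun_prop)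
    (fun _ => le_max_right _ _) (fun _ => le_max_right _ _) htail ht
  calc _ ≤ ∫⁻ x, (1 + ENNReal.ofReal (rexp (t * max (f x - M) 0) - 1)) ∂γ := by
        refine lintegral_mono fun x => ?_
        have h0 : 1 ≤ rexp (t * max (f x - M) 0) := Real.one_le_exp (by positivity)
        rw [← ENNReal.ofReal_one, ← ENNReal.ofReal_add zero_le_one (sub_nonneg.2 h0),
          add_sub_cancel]
        gcongr
        exact le_max_left _ _
    _ = 1 + ∫⁻ x, ENNReal.ofReal (rexp (t * max (f x - M) 0) - 1) ∂γ := by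
        rw [lintegral_add_left measurable_const]; simp
    _ ≤ 1 + ∫⁻ y, ENNReal.ofReal (rexp (t * max y 0) - 1) ∂gaussianReal 0 1 := by gcongr
    _ ≤ 1 + ∫⁻ y, ENNReal.ofReal (rexp (t * y)) ∂gaussianReal 0 1 := by
        gcongr with y
        rcases le_total y 0 with hy | hy
        · simpa [hy] using (Real.exp_pos _).le
        · rw [max_eq_left hy]; linarith
    _ = ENNReal.ofReal (1 + rexp (t ^ 2 / 2)) := by
        rw [lintegral_exp_mul_gaussianReal, ENNReal.ofReal_add zero_le_one (Real.exp_pos _).le,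
          ENNReal.ofReal_one]
    _ ≤ _ := by
        gcongr
        linarith [Real.one_le_exp (by positivity : 0 ≤ t ^ 2 / 2)]

lemma lintegral_exp_mul_le {n : ℕ} {f : EuclideanSpace ℝ (Fin n) → ℝ}
    (hf : LipschitzWith 1 f) {M : ℝ}
    (hM1 : (1 : ℝ) / 2 ≤ (ProbabilityTheory.stdGaussian _).real {x | f x ≤ M})
    (hM2 : (1 : ℝ) / 2 ≤ (ProbabilityTheory.stdGaussian _).real {x | M ≤ f x}) (t : ℝ) :
    ∫⁻ x, ENNReal.ofReal (rexp (t * f x)) ∂ProbabilityTheory.stdGaussian _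
      ≤ ENNReal.ofReal (2 * rexp (t * M + t ^ 2 / 2)) := by
  have hfm : Measurable f := hf.continuous.measurable
  have h : ∫⁻ x, ENNReal.ofReal (rexp (t * (f x - M))) ∂ProbabilityTheory.stdGaussian _
      ≤ ENNReal.ofReal (2 * rexp (t ^ 2 / 2)) := by
    rcases le_total 0 t with ht | ht
    · exact lintegral_exp_mul_sub_le hf hM1 ht
    · have := lintegral_exp_mul_sub_le (f := fun x => -f x) (M := -M) hf.neg
        (by simpa using hM2) (neg_nonneg.2 ht)
      simpa only [neg_sq, neg_sub_neg, neg_mul, ← mul_neg, neg_sub] using this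
  calc _ = ∫⁻ x, ENNReal.ofReal (rexp (t * M)) * ENNReal.ofReal (rexp (t * (f x - M)))
        ∂ProbabilityTheory.stdGaussian _ := by
        refine lintegral_congr fun x => ?_
        rw [← ENNReal.ofReal_mul (Real.exp_pos _).le, ← Real.exp_add]
        ring_nf
    _ = ENNReal.ofReal (rexp (t * M)) * ∫⁻ x, ENNReal.ofReal (rexp (t * (f x - M)))
        ∂ProbabilityTheory.stdGaussian _ := lintegral_const_mul _ (by fun_prop)
    _ ≤ ENNReal.ofReal (rexp (t * M)) * ENNReal.ofReal (2 * rexp (t ^ 2 / 2)) := by gcongr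
    _ = _ := by
        rw [← ENNReal.ofReal_mul (Real.exp_pos _).le, Real.exp_add]
        ring_nf

lemma lintegral_exp_sq_le {n : ℕ} {f : EuclideanSpace ℝ (Fin n) → ℝ}
    (hf : LipschitzWith 1 f) {M : ℝ}
    (hM1 : (1 : ℝ) / 2 ≤ (ProbabilityTheory.stdGaussian _).real {x | f x ≤ M})
    (hM2 : (1 : ℝ) / 2 ≤ (ProbabilityTheory.stdGaussian _).real {x | M ≤ f x})
    {l : ℝ} (hl : l ∈ Ioo (0 : ℝ) 1) :
    ∫⁻ x, ENNReal.ofReal (rexp (l * f x ^ 2 / 2)) ∂ProbabilityTheory.stdGaussian _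
      ≤ ENNReal.ofReal (2 / √(1 - l) * rexp (l * M ^ 2 / (2 * (1 - l)))) := by
  have hfm : Measurable f := hf.continuous.measurable
  have hs : √l ^ 2 = l := Real.sq_sqrt hl.1.le
  calc _ = ∫⁻ x, ∫⁻ z, ENNReal.ofReal (rexp (√l * z * f x)) ∂gaussianReal 0 1
        ∂ProbabilityTheory.stdGaussian _ := by
        refine lintegral_congr fun x => ?_
        simp only [mul_right_comm (√l) _ (f x)]
        rw [lintegral_exp_mul_gaussianReal, mul_pow, hs]
    _ = ∫⁻ z, ∫⁻ x, ENNReal.ofReal (rexp (√l * z * f x)) ∂ProbabilityTheory.stdGaussian _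
        ∂gaussianReal 0 1 := by
        refine lintegral_lintegral_swap (Measurable.aemeasurable ?_)
        simp only [Function.uncurry_def]
        fun_prop
    _ ≤ ∫⁻ z, ENNReal.ofReal (2 * rexp (√l * z * M + (√l * z) ^ 2 / 2)) ∂gaussianReal 0 1 :=
        lintegral_mono fun z => lintegral_exp_mul_le hf hM1 hM2 _
    _ = ∫⁻ z, ENNReal.ofReal 2 * ENNReal.ofReal (rexp (√l * M * z + l * z ^ 2 / 2))
        ∂gaussianReal 0 1 := by
        refine lintegral_congr fun z => ?_
        rw [← ENNReal.ofReal_mul zero_le_two, mul_pow, hs, mul_right_comm]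
    _ = _ := by
        rw [lintegral_const_mul _ (by fun_prop), lintegral_exp_mul_add_sq_gaussianReal _ hl.2,
          ← ENNReal.ofReal_mul zero_le_two, mul_pow, hs, ← mul_assoc, mul_one_div]

lemma map_toLp_stdGaussian (n : ℕ) : (_root_.stdGaussian n).map (WithLp.toLp 2)
    = ProbabilityTheory.stdGaussian (EuclideanSpace ℝ (Fin n)) :=
  map_pi_eq_stdGaussian

end

/-- if f : ℝⁿ → ℝ is 1-Lipschitz (for the Euclidean distance) with
median M under γₙ, then for 0 < λ < 1,
∫ exp(λf²/2) dγₙ ≤ (2/√(1-λ))·exp(λM²/(2(1-λ))). -/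
theorem lipschitz_gaussian_exp_square (n : ℕ) (f : (Fin n → ℝ) → ℝ)
    (hLip : ∀ x y, |f x - f y| ≤ Real.sqrt (∑ i, (x i - y i) ^ 2))
    (M : ℝ)
    (hM1 : (1 : ℝ≥0∞) / 2 ≤ stdGaussian n {x | f x ≤ M})
    (hM2 : (1 : ℝ≥0∞) / 2 ≤ stdGaussian n {x | M ≤ f x})
    (lam : ℝ) (hlam : lam ∈ Set.Ioo (0 : ℝ) 1) :
    ∫ x, Real.exp (lam * f x ^ 2 / 2) ∂(stdGaussian n)
      ≤ 2 / Real.sqrt (1 - lam) * Real.exp (lam * M ^ 2 / (2 * (1 - lam))) := by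
  let F : EuclideanSpace ℝ (Fin n) → ℝ := fun x => f x.ofLp
  have hF : LipschitzWith 1 F := LipschitzWith.of_dist_le_mul fun x y => by
    rw [NNReal.coe_one, one_mul, EuclideanSpace.dist_eq, Real.dist_eq]
    simpa only [Real.dist_eq, sq_abs] using hLip x.ofLp y.ofLp
  have hFm : Measurable F := hF.continuous.measurable
  have hT : Measurable (WithLp.toLp 2 : (Fin n → ℝ) → EuclideanSpace ℝ (Fin n)) := by fun_prop
  have hmed : ∀ s : Set (EuclideanSpace ℝ (Fin n)), MeasurableSet s →
      (1 : ℝ≥0∞) / 2 ≤ _root_.stdGaussian n (WithLp.toLp 2 ⁻¹' s) →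
      (1 : ℝ) / 2 ≤ (ProbabilityTheory.stdGaussian _).real s := fun s hs h => by
    rw [← Measure.map_apply hT hs, map_toLp_stdGaussian] at h
    simpa [Measure.real] using ENNReal.toReal_mono (measure_ne_top _ _) h
  have h := lintegral_exp_sq_le hF
    (hmed {x | F x ≤ M} (measurableSet_le hFm measurable_const) hM1)
    (hmed {x | M ≤ F x} (measurableSet_le measurable_const hFm) hM2) hlam
  rw [← map_toLp_stdGaussian, lintegral_map (by fun_prop) hT] at h
  have hfm : Measurable f := hFm.comp hT
  rw [integral_eq_lintegral_of_nonneg_ae (ae_of_all _ fun x => (Real.exp_pos _).le)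
    (by fun_prop)]
  exact ENNReal.toReal_le_of_le_ofReal (by positivity) h
end
end

section
/- There is an absolute constant C such that for any half-space B ⊂ ℝⁿ, any measurable A ⊂ ℝⁿ, and any t > 0: γₙ(A Δ B) ≤ C·max{ E|Pₜ1_A - Pₜ1_B|, (e^{2t}-1)^{1/4}·√(E|Pₜ1_A - Pₜ1_B|) }. -/
open MeasureTheory Real ProbabilityTheory

noncomputable section

open scoped NNReal

instance isProbabilityMeasure_stdGaussian_pi (n : ℕ) :
    IsProbabilityMeasure (_root_.stdGaussian n) := by
  unfold _root_.stdGaussian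
  infer_instance

lemma map_linear_stdGaussian_pi {n : ℕ} (a : Fin n → ℝ) :
    (_root_.stdGaussian n).map (fun x ↦ ∑ i, a i * x i)
      = gaussianReal 0 (∑ i, a i ^ 2).toNNReal := by
  have hm : Measurable (fun x : Fin n → ℝ ↦ ∑ i, a i * x i) := by fun_prop
  have := Measure.isProbabilityMeasure_map (μ := _root_.stdGaussian n) hm.aemeasurable
  apply Measure.ext_of_charFun
  ext t
  rw [charFun_apply_real, integral_map hm.aemeasurable (by fun_prop), _root_.stdGaussian]
  have h (x : Fin n → ℝ) : Complex.exp (t * (∑ i, a i * x i : ℝ) * Complex.I)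
      = ∏ i, Complex.exp ((t * a i : ℝ) * x i * Complex.I) := by
    rw [← Complex.exp_sum]
    push_cast
    rw [Finset.mul_sum, Finset.sum_mul]
    simp only [mul_assoc]
  simp_rw [h]
  rw [integral_fintype_prod_eq_prod
    (f := fun i (x : ℝ) ↦ Complex.exp ((t * a i : ℝ) * x * Complex.I))]
  simp_rw [← charFun_apply_real, charFun_gaussianReal, ← Complex.exp_sum]
  rw [Real.coe_toNNReal _ (by positivity)]
  congr 1
  simp [← Finset.sum_div, mul_pow, ← Finset.mul_sum, mul_comm]

lemma map_dual_stdGaussian_pi {n : ℕ} (L : StrongDual ℝ (Fin n → ℝ)) :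
    (_root_.stdGaussian n).map L
      = gaussianReal 0 (∑ i, L (Pi.single i 1) ^ 2).toNNReal := by
  rw [← map_linear_stdGaussian_pi]
  congr 1
  ext x
  conv_lhs => rw [pi_eq_sum_univ' x]
  simp [mul_comm, Pi.single]

instance isGaussian_stdGaussian_pi (n : ℕ) : IsGaussian (_root_.stdGaussian n) :=
  isGaussian_of_map_eq_gaussianReal fun L ↦ ⟨_, _, map_dual_stdGaussian_pi L⟩

lemma map_rotation_stdGaussian_pi (n : ℕ) (θ : ℝ) :
    ((_root_.stdGaussian n).prod (_root_.stdGaussian n)).map (ContinuousLinearMap.rotation θ)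
      = (_root_.stdGaussian n).prod (_root_.stdGaussian n) := by
  refine IsGaussian.map_rotation_eq_self_of_forall_strongDual_eq_zero (fun L ↦ ?_) θ
  have h := integral_map (μ := _root_.stdGaussian n) (φ := L) L.continuous.aemeasurable
    (f := fun y ↦ y) (by fun_prop)
  rw [map_dual_stdGaussian_pi, integral_id_gaussianReal] at h
  exact h.symm

lemma gaussianPDFReal_std_le (x : ℝ) : gaussianPDFReal 0 1 x ≤ 1 / 2 := by
  rw [gaussianPDFReal]
  have h2 : (2 : ℝ) ≤ √(2 * π * (1 : ℝ≥0)) := by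
    apply Real.le_sqrt_of_sq_le
    have := Real.pi_gt_three
    norm_num; linarith
  have h3 : rexp (-(x - 0) ^ 2 / (2 * (1 : ℝ≥0))) ≤ 1 := by
    rw [Real.exp_le_one_iff]
    simp only [NNReal.coe_one]
    nlinarith [sq_nonneg (x - 0)]
  calc _ ≤ (√(2 * π * (1 : ℝ≥0)))⁻¹ * 1 := by gcongr
    _ ≤ 1 / 2 := by rw [mul_one, one_div]; gcongr

lemma le_gaussianPDFReal_std {x : ℝ} (hx : |x| ≤ 1) : 1 / 6 ≤ gaussianPDFReal 0 1 x := by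
  rw [gaussianPDFReal]
  have h2 : √(2 * π * (1 : ℝ≥0)) ≤ 3 := by
    apply Real.sqrt_le_iff.2
    have := Real.pi_lt_d2
    norm_num; linarith
  have h3 : 1 / 2 ≤ rexp (-(x - 0) ^ 2 / (2 * (1 : ℝ≥0))) := by
    have := Real.add_one_le_exp (-(x - 0) ^ 2 / (2 * (1 : ℝ≥0)))
    simp only [NNReal.coe_one] at *
    have : x ^ 2 ≤ 1 := (sq_le_one_iff_abs_le_one x).2 hx
    simp only [sub_zero] at *
    linarith
  have h0 : 0 < √(2 * π * (1 : ℝ≥0)) := by simp; positivity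
  calc (1 : ℝ) / 6 = 3⁻¹ * (1 / 2) := by norm_num
    _ ≤ _ := by gcongr

lemma gaussianReal_Ioo_le {b δ : ℝ} (hδ : 0 ≤ δ) :
    (gaussianReal 0 1).real (Set.Ioo (b - δ) (b + δ)) ≤ δ := by
  rw [measureReal_def, gaussianReal_apply_eq_integral _ one_ne_zero]
  have h : ∫ x in Set.Ioo (b - δ) (b + δ), gaussianPDFReal 0 1 x
      ≤ ∫ x in Set.Ioo (b - δ) (b + δ), (1 / 2 : ℝ) :=
    setIntegral_mono (integrable_gaussianPDFReal _ _).integrableOn (by simp)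
      gaussianPDFReal_std_le
  rw [ENNReal.toReal_ofReal (integral_nonneg (gaussianPDFReal_nonneg 0 1))]
  refine h.trans (le_of_eq ?_)
  simp
  rw [max_eq_left (by linarith)]; ring

lemma min_le_gaussianReal_Ioo {r : ℝ} (hr : 0 ≤ r) :
    min r 1 / 3 ≤ (gaussianReal 0 1).real (Set.Ioo (-r) r) := by
  set m := min r 1 with hm
  have hm0 : 0 ≤ m := by positivity
  calc m / 3 ≤ (gaussianReal 0 1).real (Set.Ioo (-m) m) := ?_
    _ ≤ _ := measureReal_mono (Set.Ioo_subset_Ioo (by simp [hm]) (by simp [hm]))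
  rw [measureReal_def, gaussianReal_apply_eq_integral _ one_ne_zero,
    ENNReal.toReal_ofReal (integral_nonneg (gaussianPDFReal_nonneg 0 1))]
  have h : ∫ x in Set.Ioo (-m) m, (1 / 6 : ℝ) ≤ ∫ x in Set.Ioo (-m) m, gaussianPDFReal 0 1 x := by
    refine setIntegral_mono_on (by simp) (integrable_gaussianPDFReal _ _).integrableOn
      measurableSet_Ioo fun x hx ↦ le_gaussianPDFReal_std ?_
    have : m ≤ 1 := by simp [hm]
    rw [abs_le]; constructor <;> linarith [hx.1, hx.2]
  refine le_trans (le_of_eq ?_) h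
  simp
  rw [max_eq_left (by linarith)]; ring

/-- The sign of a real number, with the value `-1` at `0`. -/
def leftSign (u : ℝ) : ℝ := if u ≤ 0 then -1 else 1

lemma measurable_leftSign : Measurable leftSign :=
  Measurable.ite measurableSet_Iic measurable_const measurable_const

lemma abs_leftSign (u : ℝ) : |leftSign u| = 1 := by
  unfold leftSign; split_ifs <;> simp

lemma leftSign_mul_of_pos {c : ℝ} (hc : 0 < c) (u : ℝ) : leftSign (c * u) = leftSign u := by
  simp [leftSign, mul_nonpos_iff, hc.le, not_le.2 hc]

lemma integrable_of_abs_le_one {α : Type*} [MeasurableSpace α] {μ : Measure α} [IsFiniteMeasure μ]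
    {f : α → ℝ} (hf : Measurable f) (h : ∀ x, |f x| ≤ 1) : Integrable f μ :=
  .of_bound hf.aestronglyMeasurable 1 (ae_of_all _ h)

lemma two_mul_integral_leftSign_sub (u : ℝ) :
    2 * ∫ z, leftSign (u - z) ∂(gaussianReal 0 1)
      = ∫ z, (leftSign (u - z) + leftSign (u + z)) ∂(gaussianReal 0 1) := by
  have hm := measurable_leftSign
  have h : ∫ z, leftSign (u - z) ∂(gaussianReal 0 1)
      = ∫ z, leftSign (u + z) ∂(gaussianReal 0 1) := by
    have h' := integral_map (μ := gaussianReal 0 1) (φ := fun x ↦ -x) (by fun_prop)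
      (f := fun z ↦ leftSign (u - z))
      (hm.comp (measurable_const.sub measurable_id)).aestronglyMeasurable
    rw [gaussianReal_map_neg] at h'
    simpa using h'
  rw [integral_add, ← h, two_mul]
  · exact integrable_of_abs_le_one (hm.comp (by fun_prop)) fun _ ↦ (abs_leftSign _).le
  · exact integrable_of_abs_le_one (hm.comp (by fun_prop)) fun _ ↦ (abs_leftSign _).le

lemma integrable_leftSign_add (u : ℝ) :
    Integrable (fun z ↦ leftSign (u - z) + leftSign (u + z)) (gaussianReal 0 1) := by
  have hm := measurable_leftSign
  refine .add (integrable_of_abs_le_one (hm.comp (by fun_prop)) fun _ ↦ (abs_leftSign _).le)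
    (integrable_of_abs_le_one (hm.comp (by fun_prop)) fun _ ↦ (abs_leftSign _).le)

lemma integral_indicator_Ioo_two (r : ℝ) :
    ∫ z, (Set.Ioo (-r) r).indicator (fun _ ↦ (2 : ℝ)) z ∂(gaussianReal 0 1)
      = 2 * (gaussianReal 0 1).real (Set.Ioo (-r) r) := by
  rw [integral_indicator_const _ measurableSet_Ioo, smul_eq_mul, mul_comm]

lemma gaussianReal_Ioo_le_integral_leftSign {u r : ℝ} (hu : 0 < u) (hr : r ≤ u) :
    (gaussianReal 0 1).real (Set.Ioo (-r) r) ≤ ∫ z, leftSign (u - z) ∂(gaussianReal 0 1) := by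
  have h : ∫ z, (Set.Ioo (-r) r).indicator (fun _ ↦ (2 : ℝ)) z ∂(gaussianReal 0 1)
      ≤ ∫ z, (leftSign (u - z) + leftSign (u + z)) ∂(gaussianReal 0 1) := by
    refine integral_mono ((integrable_const _).indicator measurableSet_Ioo)
      (integrable_leftSign_add u) fun z ↦ ?_
    simp only [Set.indicator_apply, Set.mem_Ioo, leftSign]
    split_ifs <;> grind
  rw [← two_mul_integral_leftSign_sub, integral_indicator_Ioo_two] at h
  linarith

lemma integral_leftSign_le_neg_gaussianReal_Ioo {u r : ℝ} (hu : u ≤ 0) (hr : r ≤ -u) :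
    ∫ z, leftSign (u - z) ∂(gaussianReal 0 1) ≤ -(gaussianReal 0 1).real (Set.Ioo (-r) r) := by
  have h : ∫ z, (leftSign (u - z) + leftSign (u + z)) ∂(gaussianReal 0 1)
      ≤ ∫ z, -(Set.Ioo (-r) r).indicator (fun _ ↦ (2 : ℝ)) z ∂(gaussianReal 0 1) := by
    refine integral_mono (integrable_leftSign_add u)
      ((integrable_const _).indicator measurableSet_Ioo).neg fun z ↦ ?_
    simp only [Set.indicator_apply, Set.mem_Ioo, leftSign]
    split_ifs <;> grind
  rw [← two_mul_integral_leftSign_sub, integral_neg, integral_indicator_Ioo_two] at h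
  linarith

/-- Self-adjointness of the Mehler kernel on bounded functions, as a consequence of the rotation
invariance of the Gaussian measure. -/
lemma integral_mul_mehler_comm {n : ℕ} {F φ : (Fin n → ℝ) → ℝ} (hF : Measurable F)
    (hφ : Measurable φ) (hF1 : ∀ x, |F x| ≤ 1) (hφ1 : ∀ x, |φ x| ≤ 1) {c s : ℝ}
    (hcs : c ^ 2 + s ^ 2 = 1) :
    ∫ x, φ x * ∫ y, F (c • x + s • y) ∂(_root_.stdGaussian n) ∂(_root_.stdGaussian n)
      = ∫ x, F x * ∫ y, φ (c • x - s • y) ∂(_root_.stdGaussian n) ∂(_root_.stdGaussian n) := by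
  set γ := _root_.stdGaussian n
  obtain ⟨θ, hc, hs⟩ : ∃ θ : ℝ, cos θ = c ∧ sin θ = s := by
    have hz : ‖(⟨c, s⟩ : ℂ)‖ = 1 := by
      rw [Complex.norm_def, Complex.normSq_mk, ← sq, ← sq, hcs, Real.sqrt_one]
    have h0 : (⟨c, s⟩ : ℂ) ≠ 0 := by rw [← norm_pos_iff, hz]; norm_num
    exact ⟨Complex.arg ⟨c, s⟩, by rw [Complex.cos_arg h0, hz, div_one],
      by rw [Complex.sin_arg, hz, div_one]⟩
  have hmul {u v : ℝ} (hu : |u| ≤ 1) (hv : |v| ≤ 1) : |u * v| ≤ 1 := by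
    rw [abs_mul]; exact mul_le_one₀ hu (abs_nonneg _) hv
  have hL : Measurable fun p : (Fin n → ℝ) × (Fin n → ℝ) ↦ φ p.1 * F (c • p.1 + s • p.2) :=
    (hφ.comp measurable_fst).mul (hF.comp (by fun_prop))
  have hR : Measurable fun p : (Fin n → ℝ) × (Fin n → ℝ) ↦ F p.1 * φ (c • p.1 - s • p.2) :=
    (hF.comp measurable_fst).mul (hφ.comp (by fun_prop))
  simp_rw [← integral_const_mul]
  rw [integral_integral (f := fun x y ↦ φ x * F (c • x + s • y))
      (integrable_of_abs_le_one hL fun p ↦ hmul (hφ1 p.1) (hF1 _)),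
    integral_integral (f := fun x y ↦ F x * φ (c • x - s • y))
      (integrable_of_abs_le_one hR fun p ↦ hmul (hF1 p.1) (hφ1 _))]
  conv_rhs => rw [← map_rotation_stdGaussian_pi n θ]
  rw [integral_map (ContinuousLinearMap.continuous _).aemeasurable hR.aestronglyMeasurable]
  refine integral_congr_ae (ae_of_all _ fun p ↦ ?_)
  simp only [ContinuousLinearMap.rotation_apply, hc, hs]
  have : c • (c • p.1 + s • p.2) - s • (-s • p.1 + c • p.2) = p.1 := by
    ext i
    simp only [Pi.sub_apply, Pi.add_apply, Pi.smul_apply, smul_eq_mul]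
    linear_combination p.1 i * hcs
  rw [this, mul_comm]

lemma integral_comp_linear_stdGaussian_pi {n : ℕ} {a : Fin n → ℝ} (ha : ∑ i, a i ^ 2 = 1)
    {f : ℝ → ℝ} (hf : Measurable f) :
    ∫ x, f (∑ i, a i * x i) ∂(_root_.stdGaussian n) = ∫ z, f z ∂(gaussianReal 0 1) := by
  have hm : Measurable (fun x : Fin n → ℝ ↦ ∑ i, a i * x i) := by fun_prop
  rw [← integral_map hm.aemeasurable hf.aestronglyMeasurable, map_linear_stdGaussian_pi, ha,
    Real.toNNReal_one]

lemma integral_leftSign_mehler {n : ℕ} {a : Fin n → ℝ} (ha : ∑ i, a i ^ 2 = 1) (b : ℝ)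
    {c s : ℝ} (hs : 0 < s) (x : Fin n → ℝ) :
    ∫ y, leftSign (∑ i, a i * (c • x - s • y) i - c * b) ∂(_root_.stdGaussian n)
      = ∫ z, leftSign (c * (∑ i, a i * x i - b) / s - z) ∂(gaussianReal 0 1) := by
  rw [← integral_comp_linear_stdGaussian_pi ha
    (f := fun z ↦ leftSign (c * (∑ i, a i * x i - b) / s - z))
    (measurable_leftSign.comp (by fun_prop))]
  refine integral_congr_ae (ae_of_all _ fun y ↦ ?_)
  simp only
  rw [← leftSign_mul_of_pos hs (c * (∑ i, a i * x i - b) / s - ∑ i, a i * y i)]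
  congr 1
  simp only [Pi.sub_apply, Pi.smul_apply, smul_eq_mul, mul_sub, Finset.sum_sub_distrib,
    mul_left_comm _ c, mul_left_comm _ s, ← Finset.mul_sum]
  field_simp
  ring

/-- The difference of the indicator functions of two sets. -/
def indicatorDiff {α : Type*} (A B : Set α) (x : α) : ℝ :=
  A.indicator 1 x - B.indicator 1 x

lemma measurable_indicatorDiff {α : Type*} [MeasurableSpace α] {A B : Set α}
    (hA : MeasurableSet A) (hB : MeasurableSet B) : Measurable (indicatorDiff A B) :=
  (measurable_one.indicator hA).sub (measurable_one.indicator hB)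

lemma abs_indicatorDiff {α : Type*} (A B : Set α) (x : α) :
    |indicatorDiff A B x| = (symmDiff A B).indicator 1 x := by
  by_cases hA : x ∈ A <;> by_cases hB : x ∈ B <;>
    simp [indicatorDiff, Set.mem_symmDiff, hA, hB]

lemma abs_indicatorDiff_le_one {α : Type*} (A B : Set α) (x : α) : |indicatorDiff A B x| ≤ 1 := by
  rw [abs_indicatorDiff]
  exact Set.indicator_le_self' (by simp) x

lemma OU_sub_OU_indicator {n : ℕ} {A B : Set (Fin n → ℝ)} (hA : MeasurableSet A)
    (hB : MeasurableSet B) (t : ℝ) (x : Fin n → ℝ) :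
    OU n t (A.indicator 1) x - OU n t (B.indicator 1) x
      = ∫ y, indicatorDiff A B (rexp (-t) • x + √(1 - rexp (-2 * t)) • y)
        ∂(_root_.stdGaussian n) := by
  have h {S : Set (Fin n → ℝ)} (hS : MeasurableSet S) :
      Integrable (fun y ↦ S.indicator (1 : (Fin n → ℝ) → ℝ)
        (rexp (-t) • x + √(1 - rexp (-2 * t)) • y)) (_root_.stdGaussian n) := by
    refine integrable_of_abs_le_one ((measurable_one.indicator hS).comp (by fun_prop)) fun y ↦ ?_
    classical
    rw [Set.indicator_apply]
    split_ifs <;> simp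
  unfold indicatorDiff
  rw [integral_sub (h hA) (h hB)]
  rfl

/-- Quantitative comparison of `1_A - 1_B` with the smoothed sign of `x ↦ ⟨a, x⟩ - b`, where `B` is
the half-space `{⟨a, x⟩ ≤ b}`. -/
lemma le_indicatorDiff_mul_integral_leftSign {n : ℕ} (A : Set (Fin n → ℝ)) (a : Fin n → ℝ)
    {b κ δ : ℝ} (hκ : 0 < κ) (hδ : 0 ≤ δ) (x : Fin n → ℝ) :
    min (κ * δ) 1 / 3 * (|indicatorDiff A {x | ∑ i, a i * x i ≤ b} x|
        - (Set.Ioo (b - δ) (b + δ)).indicator 1 (∑ i, a i * x i))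
      ≤ indicatorDiff A {x | ∑ i, a i * x i ≤ b} x
        * ∫ z, leftSign (κ * (∑ i, a i * x i - b) - z) ∂(gaussianReal 0 1) := by
  set F := indicatorDiff A {x | ∑ i, a i * x i ≤ b} x with hF
  set l := ∑ i, a i * x i with hl
  set K := ∫ z, leftSign (κ * (l - b) - z) ∂(gaussianReal 0 1)
  set m := min (κ * δ) 1 / 3
  have hm : 0 ≤ m := by positivity
  have hq : m ≤ (gaussianReal 0 1).real (Set.Ioo (-(κ * δ)) (κ * δ)) :=
    min_le_gaussianReal_Ioo (by positivity)
  have hF1 : |F| ≤ 1 := abs_indicatorDiff_le_one _ _ _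
  have hF0 := abs_nonneg F
  have hFK : F * K = |F| * |K| := by
    rw [← abs_mul, eq_comm, abs_eq_self]
    rcases le_or_gt l b with h | h
    · have hu : κ * (l - b) ≤ 0 := mul_nonpos_of_nonneg_of_nonpos hκ.le (by linarith)
      have hK : K ≤ 0 := (integral_leftSign_le_neg_gaussianReal_Ioo hu le_rfl).trans
        (neg_nonpos.2 measureReal_nonneg)
      refine mul_nonneg_of_nonpos_of_nonpos ?_ hK
      have hx : x ∈ {x : Fin n → ℝ | ∑ i, a i * x i ≤ b} := h
      by_cases hA : x ∈ A <;> simp [hF, indicatorDiff, hx, hA]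
    · have hu : 0 < κ * (l - b) := mul_pos hκ (by linarith)
      have hK : 0 ≤ K := measureReal_nonneg.trans (gaussianReal_Ioo_le_integral_leftSign hu le_rfl)
      refine mul_nonneg ?_ hK
      have hx : x ∉ {x : Fin n → ℝ | ∑ i, a i * x i ≤ b} := not_le.2 h
      by_cases hA : x ∈ A <;> simp [hF, indicatorDiff, hx, hA]
  rw [hFK]
  by_cases hS : l ∈ Set.Ioo (b - δ) (b + δ)
  · rw [Set.indicator_of_mem hS, Pi.one_apply]
    exact (mul_nonpos_of_nonneg_of_nonpos hm (by linarith)).trans (by positivity)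
  · rw [Set.indicator_of_notMem hS, sub_zero, mul_comm]
    gcongr
    rcases le_or_gt l b with h | h
    · have hu : κ * (l - b) ≤ 0 := mul_nonpos_of_nonneg_of_nonpos hκ.le (by linarith)
      have hd : δ ≤ b - l := by
        by_contra! h'
        exact hS ⟨by linarith, by linarith⟩
      have := integral_leftSign_le_neg_gaussianReal_Ioo hu (r := κ * δ)
        (by nlinarith)
      exact (by linarith : m ≤ -K).trans (neg_le_abs K)
    · have hu : 0 < κ * (l - b) := mul_pos hκ (by linarith)
      have hd : δ ≤ l - b := by
        by_contra! h'
        exact hS ⟨by linarith, by linarith⟩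
      have := gaussianReal_Ioo_le_integral_leftSign hu (r := κ * δ) (by gcongr)
      exact (hq.trans this).trans (le_abs_self K)

lemma min_mul_symmDiff_sub_le_integral_OU_sub {n : ℕ} {A : Set (Fin n → ℝ)} (hA : MeasurableSet A)
    {a : Fin n → ℝ} (ha : ∑ i, a i ^ 2 = 1) (b : ℝ) {t δ : ℝ} (ht : 0 < t) (hδ : 0 ≤ δ) :
    min (δ / √(rexp (2 * t) - 1)) 1 / 3
        * ((_root_.stdGaussian n).real (symmDiff A {x | ∑ i, a i * x i ≤ b}) - δ)
      ≤ ∫ x, |OU n t (A.indicator 1) x - OU n t (Set.indicator {x | ∑ i, a i * x i ≤ b} 1) x|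
        ∂(_root_.stdGaussian n) := by
  set γ := _root_.stdGaussian n
  set B := {x : Fin n → ℝ | ∑ i, a i * x i ≤ b}
  have hlin : Measurable (fun x : Fin n → ℝ ↦ ∑ i, a i * x i) := by fun_prop
  have hB : MeasurableSet B := hlin measurableSet_Iic
  set c := rexp (-t) with hc
  set s := √(1 - rexp (-2 * t)) with hs
  set σ := √(rexp (2 * t) - 1) with hσ
  have hc2 : c ^ 2 = rexp (-2 * t) := by rw [hc, ← Real.exp_nat_mul]; congr 1; push_cast; ring
  have hlt : rexp (-2 * t) < 1 := Real.exp_lt_one_iff.2 (by linarith)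
  have hs0 : 0 < s := Real.sqrt_pos.2 (by linarith)
  have hc0 : 0 < c := Real.exp_pos _
  have hs2 : s ^ 2 = 1 - rexp (-2 * t) := Real.sq_sqrt (by linarith)
  have hcs : c ^ 2 + s ^ 2 = 1 := by rw [hc2, hs2]; ring
  have hσs : c * σ = s := by
    rw [hs, hσ, ← Real.sqrt_sq hc0.le, ← Real.sqrt_mul (sq_nonneg c), mul_sub, hc2,
      ← Real.exp_add]
    simp
  have hσ0 : 0 < σ := by
    rw [← hσs] at hs0
    exact pos_of_mul_pos_right hs0 hc0.le
  have hκ : c / s = σ⁻¹ := by rw [← hσs]; field_simp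
  set F := indicatorDiff A B
  have hF : Measurable F := measurable_indicatorDiff hA hB
  have hF1 : ∀ x, |F x| ≤ 1 := abs_indicatorDiff_le_one A B
  set φ : (Fin n → ℝ) → ℝ := fun x ↦ leftSign (∑ i, a i * x i - c * b) with hφdef
  have hφ : Measurable φ := measurable_leftSign.comp (by fun_prop)
  have hφ1 : ∀ x, |φ x| = 1 := fun x ↦ abs_leftSign _
  have hbound {G : (Fin n → ℝ) → ℝ} (hG : ∀ x, |G x| ≤ 1) : |∫ x, G x ∂γ| ≤ 1 := by
    simpa using norm_integral_le_of_norm_le_const (μ := γ) (f := G) (C := 1) (ae_of_all _ hG)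
  have hD : Measurable fun x ↦ ∫ y, F (c • x + s • y) ∂γ := by
    refine StronglyMeasurable.measurable (StronglyMeasurable.integral_prod_right
      (f := fun x y ↦ F (c • x + s • y)) (hF.comp ?_).stronglyMeasurable)
    fun_prop
  have hE : Measurable fun x ↦ ∫ y, φ (c • x - s • y) ∂γ := by
    refine StronglyMeasurable.measurable (StronglyMeasurable.integral_prod_right
      (f := fun x y ↦ φ (c • x - s • y)) (hφ.comp ?_).stronglyMeasurable)
    fun_prop
  have hmul {u v : ℝ} (hu : |u| ≤ 1) (hv : |v| ≤ 1) : |u * v| ≤ 1 := by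
    rw [abs_mul]; exact mul_le_one₀ hu (abs_nonneg _) hv
  have hFint : ∫ x, |F x| ∂γ = γ.real (symmDiff A B) := by
    simp_rw [F, abs_indicatorDiff]
    exact integral_indicator_one (hA.symmDiff hB)
  have hSint : ∫ x, (Set.Ioo (b - δ) (b + δ)).indicator (1 : ℝ → ℝ) (∑ i, a i * x i) ∂γ ≤ δ := by
    rw [integral_comp_linear_stdGaussian_pi ha (measurable_one.indicator measurableSet_Ioo),
      integral_indicator_one measurableSet_Ioo]
    exact gaussianReal_Ioo_le hδ
  have hF_int : Integrable (fun x ↦ |F x|) γ :=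
    integrable_of_abs_le_one hF.abs (by simpa using hF1)
  have hS_int : Integrable
      (fun x ↦ (Set.Ioo (b - δ) (b + δ)).indicator (1 : ℝ → ℝ) (∑ i, a i * x i)) γ := by
    refine integrable_of_abs_le_one
      ((measurable_one.indicator measurableSet_Ioo).comp hlin) fun x ↦ ?_
    simp only [Set.indicator_apply]
    split_ifs <;> simp
  calc min (δ / σ) 1 / 3 * (γ.real (symmDiff A B) - δ)
      ≤ min (δ / σ) 1 / 3 * (∫ x, |F x| ∂γ
        - ∫ x, (Set.Ioo (b - δ) (b + δ)).indicator 1 (∑ i, a i * x i) ∂γ) := by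
        rw [hFint]; gcongr
    _ = ∫ x, min (δ / σ) 1 / 3 * (|F x|
        - (Set.Ioo (b - δ) (b + δ)).indicator 1 (∑ i, a i * x i)) ∂γ := by
        rw [integral_const_mul, integral_sub hF_int hS_int]
    _ ≤ ∫ x, F x * ∫ y, φ (c • x - s • y) ∂γ ∂γ := by
        refine integral_mono ((hF_int.sub hS_int).const_mul _)
          (integrable_of_abs_le_one (hF.mul hE) fun x ↦ hmul (hF1 x)
            (hbound fun y ↦ (hφ1 _).le)) fun x ↦ ?_
        have h := le_indicatorDiff_mul_integral_leftSign A a (b := b) (inv_pos.2 hσ0) hδ x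
        rw [← div_eq_inv_mul] at h
        simp only [hφdef]
        rw [integral_leftSign_mehler ha b hs0, mul_div_right_comm, hκ]
        exact h
    _ = ∫ x, φ x * ∫ y, F (c • x + s • y) ∂γ ∂γ :=
        (integral_mul_mehler_comm hF hφ hF1 (fun x ↦ (hφ1 x).le) hcs).symm
    _ ≤ ∫ x, |OU n t (A.indicator 1) x - OU n t (B.indicator 1) x| ∂γ := by
        simp_rw [OU_sub_OU_indicator hA hB]
        refine integral_mono (integrable_of_abs_le_one (hφ.mul hD) fun x ↦ hmul (hφ1 x).le
            (hbound fun y ↦ hF1 _))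
          (integrable_of_abs_le_one hD.abs fun x ↦ by
            rw [abs_abs]; exact hbound fun y ↦ hF1 _) fun x ↦ ?_
        refine (le_abs_self _).trans (le_of_eq ?_)
        rw [abs_mul, hφ1, one_mul]

lemma le_max_of_min_mul_le {m ε σ : ℝ} (hm : 0 ≤ m) (hσ : 0 < σ)
    (h : min (m / 2 / σ) 1 / 3 * (m - m / 2) ≤ ε) : m ≤ 6 * max ε (√σ * √ε) := by
  rcases le_total (m / 2 / σ) 1 with h1 | h1
  · rw [min_eq_left h1] at h
    have h2 : m ^ 2 ≤ 6 ^ 2 * (σ * ε) := by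
      have h3 : m ^ 2 = 12 * σ * (m / 2 / σ / 3 * (m - m / 2)) := by field_simp; ring
      have h4 : 0 ≤ m / 2 / σ / 3 * (m - m / 2) := by
        rw [show m - m / 2 = m / 2 by ring]; positivity
      rw [h3]
      nlinarith [mul_le_mul_of_nonneg_left h hσ.le]
    rw [← Real.sqrt_mul hσ.le]
    calc m ≤ √(6 ^ 2 * (σ * ε)) := Real.le_sqrt_of_sq_le h2
      _ = 6 * √(σ * ε) := by rw [Real.sqrt_mul (by norm_num), Real.sqrt_sq (by norm_num)]
      _ ≤ _ := by gcongr; exact le_max_right _ _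
  · rw [min_eq_right h1] at h
    linarith [le_max_left ε (√σ * √ε)]

lemma setOf_linear_le_eq_normalized {n : ℕ} (a : Fin n → ℝ) (b : ℝ) {k : ℝ} (hk : 0 < k) :
    {x : Fin n → ℝ | ∑ i, a i * x i ≤ b} = {x | ∑ i, a i / k * x i ≤ b / k} := by
  ext x
  simp only [Set.mem_ofPred_eq, div_mul_eq_mul_div, ← Finset.sum_div]
  exact (div_le_div_iff_of_pos_right hk).symm

/-- there is an absolute constant C such that for any half-space
B = {⟨a,x⟩ ≤ b} (a ≠ 0), any measurable A and any t > 0,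
γₙ(A Δ B) ≤ C·max{E|Pₜ1_A - Pₜ1_B|, (e^{2t}-1)^{1/4}·√(E|Pₜ1_A - Pₜ1_B|)}. -/
theorem time_reversal_symmDiff_bound :
    ∃ C : ℝ, 0 < C ∧
      ∀ (n : ℕ) (A : Set (Fin n → ℝ)), MeasurableSet A →
        ∀ (a : Fin n → ℝ) (b : ℝ), a ≠ 0 →
          ∀ t : ℝ, 0 < t →
            (stdGaussian n (symmDiff A {x | (∑ i, a i * x i) ≤ b})).toReal
              ≤ C * max
                (∫ x, |OU n t (A.indicator 1) x
                    - OU n t (Set.indicator {x | (∑ i, a i * x i) ≤ b} 1) x|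
                  ∂(stdGaussian n))
                ((Real.exp (2 * t) - 1) ^ ((1 : ℝ) / 4) *
                  Real.sqrt (∫ x, |OU n t (A.indicator 1) x
                      - OU n t (Set.indicator {x | (∑ i, a i * x i) ≤ b} 1) x|
                    ∂(stdGaussian n))) := by
  refine ⟨6, by norm_num, fun n A hA a b ha t ht ↦ ?_⟩
  have hk2 : 0 < ∑ i, a i ^ 2 := by
    obtain ⟨i, hi⟩ := Function.ne_iff.1 ha
    exact Finset.sum_pos' (fun _ _ ↦ sq_nonneg _) ⟨i, Finset.mem_univ i, sq_pos_of_ne_zero hi⟩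
  have hk : 0 < √(∑ i, a i ^ 2) := Real.sqrt_pos.2 hk2
  have ha' : ∑ i, (a i / √(∑ i, a i ^ 2)) ^ 2 = 1 := by
    simp_rw [div_pow, ← Finset.sum_div, Real.sq_sqrt hk2.le]
    exact div_self hk2.ne'
  have hexp : 0 < rexp (2 * t) - 1 := sub_pos.2 (Real.one_lt_exp_iff.2 (by linarith))
  have hpow : (rexp (2 * t) - 1) ^ ((1 : ℝ) / 4) = √(√(rexp (2 * t) - 1)) := by
    rw [Real.sqrt_eq_rpow, Real.sqrt_eq_rpow, ← Real.rpow_mul hexp.le]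
    norm_num
  rw [hpow, setOf_linear_le_eq_normalized a b hk]
  exact le_max_of_min_mul_le measureReal_nonneg (Real.sqrt_pos.2 hexp)
    (min_mul_symmDiff_sub_le_integral_OU_sub hA ha' _ ht (div_nonneg measureReal_nonneg two_pos.le))
end
end

section
/- Let g(x) = Φ(⟨a, x⟩) for some a ∈ ℝⁿ with |a| = (e^{2t}-1)^{-1/2}, t > 0, and let (X,Y) be ρ-correlated standard Gaussians, 0 < ρ < 1. Then E_ρ[g(X)g(Y)] = 1/4 + (1/(2π))·arcsin(e^{-2t}ρ). -/
open MeasureTheory Real ProbabilityTheory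

noncomputable section

/-- The joint law of a pair of ρ-correlated standard Gaussian vectors on ℝⁿ. -/
def jointGaussian (n : ℕ) (ρ : ℝ) : Measure ((Fin n → ℝ) × (Fin n → ℝ)) :=
  Measure.map (fun p => (p.1, fun i => ρ * p.1 i + Real.sqrt (1 - ρ ^ 2) * p.2 i))
    ((stdGaussian n).prod (stdGaussian n))

lemma gaussianReal_prod_apply_of_polar {B : Set (ℝ × ℝ)} (hB : MeasurableSet B)
    {Θ : Set ℝ} (hΘ : MeasurableSet Θ)
    (h : ∀ r > 0, ∀ θ ∈ Set.Ioo (-π) π, (r * cos θ, r * sin θ) ∈ B ↔ θ ∈ Θ) :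
    ((gaussianReal 0 1).prod (gaussianReal 0 1)) B =
      (∫⁻ r in Set.Ioi (0 : ℝ), ENNReal.ofReal (r * ((2 * π)⁻¹ * exp (-r ^ 2 / 2)))) *
        volume (Θ ∩ Set.Ioo (-π) π) := by
  have hpdf : ∀ r θ : ℝ, gaussianPDF 0 1 (r * cos θ) * gaussianPDF 0 1 (r * sin θ) =
      ENNReal.ofReal ((2 * π)⁻¹ * exp (-r ^ 2 / 2)) := by
    intro r θ
    rw [gaussianPDF, gaussianPDF, ← ENNReal.ofReal_mul (gaussianPDFReal_nonneg _ _ _)]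
    congr 1
    simp only [gaussianPDFReal, NNReal.coe_one, mul_one, sub_zero]
    rw [mul_mul_mul_comm, ← mul_inv, mul_self_sqrt (by positivity), ← exp_add]
    congr 2
    linear_combination (-r ^ 2 / 2) * cos_sq_add_sin_sq θ
  rw [gaussianReal_of_var_ne_zero _ one_ne_zero,
    prod_withDensity (measurable_gaussianPDF _ _) (measurable_gaussianPDF _ _),
    withDensity_apply _ hB, ← lintegral_indicator hB, ← Measure.volume_eq_prod,
    ← lintegral_comp_polarCoord_symm, polarCoord_target]
  have hcongr : ∀ p ∈ Set.Ioi (0 : ℝ) ×ˢ Set.Ioo (-π) π,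
      ENNReal.ofReal p.1 • B.indicator
        (fun z : ℝ × ℝ => gaussianPDF 0 1 z.1 * gaussianPDF 0 1 z.2) (polarCoord.symm p) =
      ENNReal.ofReal (p.1 * ((2 * π)⁻¹ * exp (-p.1 ^ 2 / 2))) * Θ.indicator 1 p.2 := by
    rintro ⟨r, θ⟩ ⟨hr, hθ⟩
    have hr' : (0 : ℝ) < r := hr
    rw [polarCoord_symm_apply]
    by_cases hm : θ ∈ Θ
    · rw [Set.indicator_of_mem ((h r hr θ hθ).2 hm), Set.indicator_of_mem hm]
      simp only [hpdf]
      rw [smul_eq_mul, ← ENNReal.ofReal_mul hr'.le, Pi.one_apply, mul_one]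
    · rw [Set.indicator_of_notMem (fun hb => hm ((h r hr θ hθ).1 hb)),
        Set.indicator_of_notMem hm, smul_zero, mul_zero]
  rw [setLIntegral_congr_fun (measurableSet_Ioi.prod measurableSet_Ioo) hcongr,
    Measure.volume_eq_prod, ← Measure.prod_restrict,
    lintegral_prod_mul
      (f := fun r : ℝ => ENNReal.ofReal (r * ((2 * π)⁻¹ * exp (-r ^ 2 / 2))))
      (by fun_prop) ((measurable_one.indicator hΘ).aemeasurable),
    lintegral_indicator_one hΘ, Measure.restrict_apply hΘ]

lemma lintegral_gaussian_radial :
    ∫⁻ r in Set.Ioi (0 : ℝ), ENNReal.ofReal (r * ((2 * π)⁻¹ * exp (-r ^ 2 / 2))) =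
      ENNReal.ofReal (2 * π)⁻¹ := by
  have h := gaussianReal_prod_apply_of_polar (B := Set.univ) MeasurableSet.univ
    (Θ := Set.univ) MeasurableSet.univ (by simp)
  rw [measure_univ, Set.univ_inter, Real.volume_Ioo, sub_neg_eq_add, ← two_mul] at h
  rw [ENNReal.ofReal_inv_of_pos (by positivity)]
  exact ENNReal.eq_inv_of_mul_eq_one_left h.symm

/-- **Sheppard's formula** for the orthant probability of a correlated Gaussian pair. -/
lemma sheppard_formula {r : ℝ} (h0 : 0 ≤ r) (h1 : r ≤ 1) :
    ((gaussianReal 0 1).prod (gaussianReal 0 1)).real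
      {p | 0 ≤ p.1 ∧ 0 ≤ r * p.1 + √(1 - r ^ 2) * p.2} = 1 / 4 + arcsin r / (2 * π) := by
  have hβ0 : 0 ≤ arcsin r := arcsin_nonneg.2 h0
  have hβ1 : arcsin r ≤ π / 2 := arcsin_le_pi_div_two r
  have hsin : sin (arcsin r) = r := sin_arcsin (by linarith) h1
  have hpi := pi_pos
  rw [measureReal_def, gaussianReal_prod_apply_of_polar (Θ := Set.Icc (-arcsin r) (π / 2)) _
    measurableSet_Icc, lintegral_gaussian_radial]
  · have hvol : volume (Set.Icc (-arcsin r) (π / 2) ∩ Set.Ioo (-π) π) =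
        ENNReal.ofReal (π / 2 + arcsin r) := by
      rw [Set.inter_eq_left.2, Real.volume_Icc, sub_neg_eq_add]
      exact fun x hx => ⟨by linarith [hx.1], by linarith [hx.2]⟩
    rw [hvol, ← ENNReal.ofReal_mul (by positivity), ENNReal.toReal_ofReal (by positivity)]
    field_simp
    ring
  · intro ρ hρ θ hθ
    have hlin : r * (ρ * cos θ) + √(1 - r ^ 2) * (ρ * sin θ) = ρ * sin (θ + arcsin r) := by
      rw [sin_add, hsin, cos_arcsin]
      ring
    simp only [Set.mem_ofPred_eq, hlin, mul_nonneg_iff_of_pos_left hρ, Set.mem_Icc]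
    constructor
    · rintro ⟨hc, hs⟩
      have h2 : θ ≤ π / 2 := by
        by_contra! hlt
        linarith [cos_neg_of_pi_div_two_lt_of_lt hlt (by linarith [hθ.2])]
      have h3 : -(π / 2) ≤ θ := by
        by_contra! hlt
        have := cos_neg_of_pi_div_two_lt_of_lt (x := -θ) (by linarith) (by linarith [hθ.1])
        rw [cos_neg] at this
        linarith
      refine ⟨?_, h2⟩
      by_contra! hlt
      linarith [sin_neg_of_neg_of_neg_pi_lt (x := θ + arcsin r) (by linarith) (by linarith [hθ.1])]
    · rintro ⟨hl, hu⟩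
      exact ⟨cos_nonneg_of_neg_pi_div_two_le_of_le (by linarith) hu,
        sin_nonneg_of_nonneg_of_le_pi (by linarith) (by linarith)⟩
  · measurability

lemma gPhi_eq_measureReal (x : ℝ) : gPhi x = (gaussianReal 0 1).real (Set.Iic x) := by
  rw [measureReal_def, gaussianReal_apply_eq_integral _ one_ne_zero, ENNReal.toReal_ofReal
    (integral_nonneg fun _ => gaussianPDFReal_nonneg _ _ _)]
  simp [gPhi, gphi, gaussianPDFReal]

lemma measurable_gPhi : Measurable gPhi := by
  refine Monotone.measurable fun x y hxy => ?_
  rw [gPhi_eq_measureReal, gPhi_eq_measureReal]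
  exact measureReal_mono (Set.Iic_subset_Iic.2 hxy)

lemma integral_cexp_gaussianReal (c : ℝ) :
    ∫ x, Complex.exp (c * x * Complex.I) ∂(gaussianReal 0 1) = Complex.exp (-c ^ 2 / 2) := by
  rw [← charFun_apply_real, charFun_gaussianReal]
  congr 1
  push_cast
  ring

lemma integral_cexp_stdGaussian (n : ℕ) (c : Fin n → ℝ) :
    ∫ x, Complex.exp ((∑ i, c i * x i : ℝ) * Complex.I) ∂(_root_.stdGaussian n) =
      Complex.exp (-(∑ i, c i ^ 2 : ℝ) / 2) := by
  have : ∀ x : Fin n → ℝ, Complex.exp ((∑ i, c i * x i : ℝ) * Complex.I) =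
      ∏ i, Complex.exp (c i * x i * Complex.I) := fun x => by
    rw [← Complex.exp_sum, ← Finset.sum_mul]
    push_cast
    rfl
  simp_rw [this, _root_.stdGaussian]
  rw [integral_fintype_prod_eq_prod (f := fun i (x : ℝ) => Complex.exp (c i * x * Complex.I))]
  simp_rw [integral_cexp_gaussianReal]
  rw [← Complex.exp_sum, ← Finset.sum_div, Finset.sum_neg_distrib]
  push_cast
  rfl

instance (n : ℕ) : IsProbabilityMeasure (_root_.stdGaussian n) := by
  unfold _root_.stdGaussian
  infer_instance

lemma prod_ext_of_integral_cexp {μ ν : Measure (ℝ × ℝ)} [IsFiniteMeasure μ] [IsFiniteMeasure ν]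
    (h : ∀ u v : ℝ, ∫ p, Complex.exp ((u * p.1 + v * p.2 : ℝ) * Complex.I) ∂μ =
      ∫ p, Complex.exp ((u * p.1 + v * p.2 : ℝ) * Complex.I) ∂ν) : μ = ν := by
  refine Measure.ext_of_charFunDual ?_
  ext L
  have hL : ∀ p : ℝ × ℝ, L p = L (1, 0) * p.1 + L (0, 1) * p.2 := fun p => by
    conv_lhs => rw [show p = p.1 • ((1, 0) : ℝ × ℝ) + p.2 • ((0, 1) : ℝ × ℝ) by ext <;> simp]
    rw [map_add, map_smul, map_smul, smul_eq_mul, smul_eq_mul, mul_comm p.1, mul_comm p.2]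
  rw [charFunDual_apply, charFunDual_apply, funext hL]
  exact h _ _

/-- Adding independent standard Gaussian noise to the pair `(⟨a, X⟩, ⟨a, Y⟩)` gives a multiple
of a correlated standard Gaussian pair. -/
lemma map_inner_sub_noise (n : ℕ) (a : Fin n → ℝ) {ρ r c : ℝ} (hρ : ρ ^ 2 ≤ 1) (hr : r ^ 2 ≤ 1)
    (hc : c ^ 2 = 1 + ∑ i, a i ^ 2) (hcr : c ^ 2 * r = ρ * ∑ i, a i ^ 2) :
    (((_root_.stdGaussian n).prod (_root_.stdGaussian n)).prod
      ((gaussianReal 0 1).prod (gaussianReal 0 1))).map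
        (fun q => (∑ i, a i * q.1.1 i - q.2.1,
          ∑ i, a i * (ρ * q.1.1 i + √(1 - ρ ^ 2) * q.1.2 i) - q.2.2)) =
    ((gaussianReal 0 1).prod (gaussianReal 0 1)).map
      (fun p => (c * p.1, c * (r * p.1 + √(1 - r ^ 2) * p.2))) := by
  have hm₁ : Measurable (fun q : ((Fin n → ℝ) × (Fin n → ℝ)) × (ℝ × ℝ) =>
      (∑ i, a i * q.1.1 i - q.2.1,
        ∑ i, a i * (ρ * q.1.1 i + √(1 - ρ ^ 2) * q.1.2 i) - q.2.2)) := by fun_prop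
  have hm₂ : Measurable (fun p : ℝ × ℝ => (c * p.1, c * (r * p.1 + √(1 - r ^ 2) * p.2))) := by
    fun_prop
  have := Measure.isProbabilityMeasure_map (μ := ((_root_.stdGaussian n).prod
    (_root_.stdGaussian n)).prod ((gaussianReal 0 1).prod (gaussianReal 0 1))) hm₁.aemeasurable
  have := Measure.isProbabilityMeasure_map
    (μ := (gaussianReal 0 1).prod (gaussianReal 0 1)) hm₂.aemeasurable
  refine prod_ext_of_integral_cexp fun u v => ?_
  rw [integral_map hm₁.aemeasurable (by fun_prop), integral_map hm₂.aemeasurable (by fun_prop)]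
  have hL : ∀ q : ((Fin n → ℝ) × (Fin n → ℝ)) × (ℝ × ℝ),
      Complex.exp ((u * (∑ i, a i * q.1.1 i - q.2.1) +
        v * (∑ i, a i * (ρ * q.1.1 i + √(1 - ρ ^ 2) * q.1.2 i) - q.2.2) : ℝ) * Complex.I) =
      (Complex.exp ((∑ i, ((u + v * ρ) * a i) * q.1.1 i : ℝ) * Complex.I) *
        Complex.exp ((∑ i, (v * √(1 - ρ ^ 2) * a i) * q.1.2 i : ℝ) * Complex.I)) *
      (Complex.exp ((-u : ℝ) * q.2.1 * Complex.I) *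
        Complex.exp ((-v : ℝ) * q.2.2 * Complex.I)) := fun q => by
    rw [← Complex.exp_add, ← Complex.exp_add, ← Complex.exp_add, ← add_mul, ← add_mul, ← add_mul]
    norm_cast
    congr 3
    simp only [mul_add, mul_sub, Finset.mul_sum, Finset.sum_add_distrib, add_mul, mul_assoc,
      mul_left_comm (a _)]
    ring
  have hR : ∀ p : ℝ × ℝ,
      Complex.exp ((u * (c * p.1) + v * (c * (r * p.1 + √(1 - r ^ 2) * p.2)) : ℝ) * Complex.I) =
      Complex.exp ((c * (u + v * r) : ℝ) * p.1 * Complex.I) *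
        Complex.exp ((c * v * √(1 - r ^ 2) : ℝ) * p.2 * Complex.I) := fun p => by
    rw [← Complex.exp_add]
    congr 1
    push_cast
    ring
  simp_rw [hL, hR]
  rw [integral_prod_mul (μ := (_root_.stdGaussian n).prod (_root_.stdGaussian n))
      (ν := (gaussianReal 0 1).prod (gaussianReal 0 1))
      (fun q => Complex.exp ((∑ i, ((u + v * ρ) * a i) * q.1 i : ℝ) * Complex.I) *
        Complex.exp ((∑ i, (v * √(1 - ρ ^ 2) * a i) * q.2 i : ℝ) * Complex.I))
      (fun q => Complex.exp ((-u : ℝ) * q.1 * Complex.I) *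
        Complex.exp ((-v : ℝ) * q.2 * Complex.I)),
    integral_prod_mul
      (fun x : Fin n → ℝ => Complex.exp ((∑ i, ((u + v * ρ) * a i) * x i : ℝ) * Complex.I))
      (fun y : Fin n → ℝ => Complex.exp ((∑ i, (v * √(1 - ρ ^ 2) * a i) * y i : ℝ) * Complex.I)),
    integral_prod_mul (fun x : ℝ => Complex.exp ((-u : ℝ) * x * Complex.I))
      (fun y : ℝ => Complex.exp ((-v : ℝ) * y * Complex.I)),
    integral_prod_mul (fun x : ℝ => Complex.exp ((c * (u + v * r) : ℝ) * x * Complex.I))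
      (fun y : ℝ => Complex.exp ((c * v * √(1 - r ^ 2) : ℝ) * y * Complex.I))]
  simp_rw [integral_cexp_stdGaussian, integral_cexp_gaussianReal]
  rw [← Complex.exp_add, ← Complex.exp_add, ← Complex.exp_add, ← Complex.exp_add]
  congr 1
  norm_cast
  simp only [mul_pow, ← Finset.mul_sum, sq_sqrt (sub_nonneg.2 hρ), sq_sqrt (sub_nonneg.2 hr)]
  linear_combination (u ^ 2 + v ^ 2) / 2 * hc + u * v * hcr

lemma integral_gPhi_mul_gPhi (n : ℕ) (a : Fin n → ℝ) {ρ r : ℝ} (hρ : ρ ^ 2 ≤ 1)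
    (hr0 : 0 ≤ r) (hr1 : r ≤ 1) (hr : (1 + ∑ i, a i ^ 2) * r = ρ * ∑ i, a i ^ 2) :
    ∫ p, gPhi (∑ i, a i * p.1 i) * gPhi (∑ i, a i * p.2 i) ∂(jointGaussian n ρ) =
      1 / 4 + arcsin r / (2 * π) := by
  have hpos : 0 < 1 + ∑ i, a i ^ 2 := by positivity
  have hcpos := sqrt_pos.2 hpos
  have hc := sq_sqrt hpos.le
  set c := √(1 + ∑ i, a i ^ 2)
  have hmΦ := measurable_gPhi
  set γ₂ := (gaussianReal 0 1).prod (gaussianReal 0 1)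
  set T : ((Fin n → ℝ) × (Fin n → ℝ)) × (ℝ × ℝ) → ℝ × ℝ := fun q =>
    (∑ i, a i * q.1.1 i - q.2.1, ∑ i, a i * (ρ * q.1.1 i + √(1 - ρ ^ 2) * q.1.2 i) - q.2.2)
    with hT
  have hTm : Measurable T := by fun_prop
  have hQ : MeasurableSet (Set.Ici (0 : ℝ) ×ˢ Set.Ici (0 : ℝ)) :=
    measurableSet_Ici.prod measurableSet_Ici
  have hsec : ∀ p : (Fin n → ℝ) × (Fin n → ℝ), gPhi (∑ i, a i * p.1 i) *
      gPhi (∑ i, a i * (ρ * p.1 i + √(1 - ρ ^ 2) * p.2 i)) =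
      (γ₂ (Prod.mk p ⁻¹' (T ⁻¹' (Set.Ici 0 ×ˢ Set.Ici 0)))).toReal := fun p => by
    rw [gPhi_eq_measureReal, gPhi_eq_measureReal, ← measureReal_prod_prod, measureReal_def]
    congr 2
    ext z
    simp [hT, Prod.le_def]
  rw [jointGaussian, integral_map (by fun_prop) (by fun_prop)]
  simp_rw [hsec]
  rw [integral_toReal (measurable_measure_prodMk_left (hTm hQ)).aemeasurable
      (ae_of_all _ fun _ => measure_lt_top _ _),
    ← Measure.prod_apply (hTm hQ), ← Measure.map_apply hTm hQ,
    map_inner_sub_noise n a hρ (by nlinarith) hc (hc ▸ hr),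
    Measure.map_apply (by fun_prop) hQ, ← sheppard_formula hr0 hr1, measureReal_def]
  congr 2
  ext p
  simp [mul_nonneg_iff_of_pos_left hcpos]

/-- for g(x) = Φ(⟨a,x⟩) with |a| = (e^{2t}-1)^{-1/2}, t > 0, and
ρ-correlated standard Gaussians, 0 < ρ < 1,
E_ρ[g(X)g(Y)] = 1/4 + arcsin(e^{-2t}ρ)/(2π). -/
theorem correlation_of_smoothed_halfspace (n : ℕ) (t : ℝ) (ht : 0 < t)
    (a : Fin n → ℝ)
    (ha : Real.sqrt (∑ i, a i ^ 2) = (Real.sqrt (Real.exp (2 * t) - 1))⁻¹)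
    (ρ : ℝ) (hρ : ρ ∈ Set.Ioo (0 : ℝ) 1) :
    ∫ p, gPhi (∑ i, a i * p.1 i) * gPhi (∑ i, a i * p.2 i) ∂(jointGaussian n ρ)
      = 1 / 4 + Real.arcsin (Real.exp (-2 * t) * ρ) / (2 * Real.pi) := by
  obtain ⟨hρ0, hρ1⟩ := hρ
  have hE : 0 < exp (2 * t) - 1 := by linarith [add_one_lt_exp (x := 2 * t) (by positivity)]
  have hS : ∑ i, a i ^ 2 = (exp (2 * t) - 1)⁻¹ := by
    rw [← sq_sqrt (show 0 ≤ ∑ i, a i ^ 2 by positivity), ha, inv_pow, sq_sqrt hE.le]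
  have hexp : exp (-2 * t) < 1 := exp_lt_one_iff.2 (by linarith)
  refine integral_gPhi_mul_gPhi n a (by nlinarith) (by positivity) (by nlinarith) ?_
  have hE' : exp (2 * t) - 1 ≠ 0 := hE.ne'
  rw [hS, neg_mul, exp_neg]
  field_simp
  ring
end
end
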